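/- arXiv:1412.5781 — 3 statements merged into one kernel-verified Lean document; each statement's English description precedes it below -/
import Mathlib

section
/- Assume C ⊆ U^{|z|} is saturated and o(C/A) has finite VC-dimension, and let M ⪯ U be an L(A;C)-saturated model. Let q(z) be the partial type {¬φ(z) : φ(z) ∈ L(M), φ(A) = ∅} (so that a global type extends q exactly when it is finitely satisfiable in A). Then there are two formulas ψ_0(z), ψ_1(z) with parameters in M such that ψ_0(U) ⊆ C, ψ_1(U) ⊆ U^{|z|} ∖ C, and q(z) ⊢ ψ_0(z) ∨ ψ_1(z). -/
namespace Paper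

open FirstOrder Language Cardinal Set

universe u

variable (L : FirstOrder.Language.{u, u}) (U : Type u) [iS : L.Structure U]

/-- A language consisting of a single `n`-ary relation symbol. -/
def predLang (n : ℕ) : FirstOrder.Language.{u, u} where
  Functions := fun _ => PEmpty
  Relations := fun m => ULift (PLift (m = n))

/-- The language `L` together with one new `n`-ary relation symbol. -/
def expLang (n : ℕ) : FirstOrder.Language.{u, u} := L.sum (predLang n)

/-- The expansion `⟨U, D⟩` of `U` by a predicate for `D ⊆ U^n`. -/
def expStr {n : ℕ} (D : Set (Fin n → U)) : (expLang L n).Structure U where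
  funMap := fun {_} f x =>
    match f with
    | Sum.inl f => Structure.funMap f x
    | Sum.inr f => f.elim
  RelMap := fun {_} r x =>
    match r with
    | Sum.inl r => Structure.RelMap r x
    | Sum.inr h => (x ∘ Fin.cast h.down.down.symm) ∈ D

/-- Add the elements of `A : Set U` as constants to an arbitrary structure on `U`. -/
def addConsts {L' : FirstOrder.Language.{u, u}} (S : L'.Structure U) (A : Set U) :
    (L'[[↥A]]).Structure U :=
  letI := S
  letI : (constantsOn ↥A).Structure U := constantsOn.structure Subtype.val
  Language.sumStructure _ _ _

/-- Add all elements of `U` as constants to an arbitrary structure on `U`. -/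
def addAllConsts {L' : FirstOrder.Language.{u, u}} (S : L'.Structure U) :
    (L'[[U]]).Structure U :=
  letI := S
  letI : (constantsOn U).Structure U := constantsOn.structure id
  Language.sumStructure _ _ _

/-- Realization of a formula with respect to an explicitly given structure. -/
def FRealize {L' : FirstOrder.Language.{u, u}} (S : L'.Structure U) {α : Type*}
    (φ : L'.Formula α) (v : α → U) : Prop :=
  @Formula.Realize L' U S α φ v

/-- Realization of a sentence with respect to an explicitly given structure. -/
def SentRealize {L' : FirstOrder.Language.{u, u}} (S : L'.Structure U) (φ : L'.Sentence) : Prop :=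
  @Sentence.Realize L' U S φ

/-- A structure on `U` is saturated if every type over a parameter set of cardinality `< #U`
which is finitely realized is realized. -/
def IsSatStr {L' : FirstOrder.Language.{u, u}} (S : L'.Structure U) : Prop :=
  ∀ A : Set U, #A < #U → ∀ (m : ℕ) (p : Set ((L'[[↥A]]).Formula (Fin m))),
    (∀ s : Finset ((L'[[↥A]]).Formula (Fin m)), ↑s ⊆ p →
      ∃ b : Fin m → U, ∀ φ ∈ s, FRealize U (addConsts U S A) φ b) →
    ∃ b : Fin m → U, ∀ φ ∈ p, FRealize U (addConsts U S A) φ b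

/-- `D ⊆ U^n` is saturated if the expansion `⟨U, D⟩` is a saturated structure. -/
def SatSet {n : ℕ} (D : Set (Fin n → U)) : Prop :=
  IsSatStr U (expStr L U D)

/-- `⟨U,C⟩ ≡_A ⟨U,D⟩` : the two expansions satisfy the same sentences with parameters in `A`. -/
def EqvOver {n : ℕ} (A : Set U) (C D : Set (Fin n → U)) : Prop :=
  ∀ φ : ((expLang L n)[[↥A]]).Sentence,
    SentRealize U (addConsts U (expStr L U C) A) φ ↔
      SentRealize U (addConsts U (expStr L U D) A) φ

/-- `e(D/A)`, the class of all `C` with `⟨U,C⟩ ≡_A ⟨U,D⟩`. -/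
def eSet {n : ℕ} (A : Set U) (D : Set (Fin n → U)) : Set (Set (Fin n → U)) :=
  {C | EqvOver L U A C D}

/-- The group `Aut(U/A)` of automorphisms of `U` fixing `A` pointwise (as a set). -/
def AutFix (A : Set U) : Set (U ≃[L] U) :=
  {f | ∀ a ∈ A, f a = a}

/-- The image of a set of tuples under an automorphism. -/
def imgSet {n : ℕ} (f : U ≃[L] U) (D : Set (Fin n → U)) : Set (Fin n → U) :=
  (fun b => ⇑f ∘ b) '' D

/-- The orbit `o(D/A)` of `D` under `Aut(U/A)`. -/
def oSet {n : ℕ} (A : Set U) (D : Set (Fin n → U)) : Set (Set (Fin n → U)) :=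
  {C | ∃ f ∈ AutFix L U A, imgSet L U f D = C}

/-- The orbit `o(b/A)` of a tuple `b` under `Aut(U/A)`. -/
def oTuple {n : ℕ} (A : Set U) (b : Fin n → U) : Set (Fin n → U) :=
  {c | ∃ f ∈ AutFix L U A, ⇑f ∘ b = c}

/-- A family of sets shatters `B` if every subset of `B` is the trace of a member. -/
def Shatters {α : Type*} (u : Set (Set α)) (B : Set α) : Prop :=
  ∀ H ⊆ B, ∃ D ∈ u, D ∩ B = H

/-- A family of sets has finite VC dimension if for some `N` it shatters no `N`-element set. -/
def FiniteVC {α : Type*} (u : Set (Set α)) : Prop :=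
  ∃ N : ℕ, ∀ B : Finset α, B.card = N → ¬Shatters u ↑B

/-- `B^{|z|}`, the set of tuples with coordinates in `B`. -/
def tuplesIn {n : ℕ} (B : Set U) : Set (Fin n → U) :=
  {a | ∀ i, a i ∈ B}

/-- `φ(b, U)`, the set defined by `φ(x,z)` with `x ↦ b`. -/
def phiSet {m n : ℕ} (φ : L.Formula (Fin m ⊕ Fin n)) (b : Fin m → U) :
    Set (Fin n → U) :=
  {a | φ.Realize (Sum.elim b a)}

/-- `D` is approximable by `φ(x,z)` : every finite trace of `D` is the trace of
some instance `φ(b,U)`. -/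
def ApproxBy {n : ℕ} (D : Set (Fin n → U)) {m : ℕ} (φ : L.Formula (Fin m ⊕ Fin n)) : Prop :=
  ∀ B : Finset U, ∃ b : Fin m → U,
    phiSet L U φ b ∩ tuplesIn U ↑B = D ∩ tuplesIn U ↑B

/-- `D` is approximable from below by `φ(x,z)`. -/
def ApproxBelowBy {n : ℕ} (D : Set (Fin n → U)) {m : ℕ}
    (φ : L.Formula (Fin m ⊕ Fin n)) : Prop :=
  ∀ B : Finset U, ∃ b : Fin m → U,
    phiSet L U φ b ∩ tuplesIn U ↑B = D ∩ tuplesIn U ↑B ∧ phiSet L U φ b ⊆ D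

/-- `D` is approximable from above by `φ(x,z)`. -/
def ApproxAboveBy {n : ℕ} (D : Set (Fin n → U)) {m : ℕ}
    (φ : L.Formula (Fin m ⊕ Fin n)) : Prop :=
  ∀ B : Finset U, ∃ b : Fin m → U,
    phiSet L U φ b ∩ tuplesIn U ↑B = D ∩ tuplesIn U ↑B ∧ D ⊆ phiSet L U φ b

def Approximable {n : ℕ} (D : Set (Fin n → U)) : Prop :=
  ∃ (m : ℕ) (φ : L.Formula (Fin m ⊕ Fin n)), ApproxBy L U D φ

def ApproxBelow {n : ℕ} (D : Set (Fin n → U)) : Prop :=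
  ∃ (m : ℕ) (φ : L.Formula (Fin m ⊕ Fin n)), ApproxBelowBy L U D φ

def ApproxAbove {n : ℕ} (D : Set (Fin n → U)) : Prop :=
  ∃ (m : ℕ) (φ : L.Formula (Fin m ⊕ Fin n)), ApproxAboveBy L U D φ

/-- The formula `φ(x, a)` (an `L(U)`-formula in the variables `x`), obtained by
substituting the tuple `a` for the variables `z` in `φ(x,z)`. -/
def instFormula {m n : ℕ} (φ : L.Formula (Fin m ⊕ Fin n)) (a : Fin n → U) :
    (L[[U]]).Formula (Fin m) :=
  ((L.lhomWithConstants U).onFormula φ).subst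
    (Sum.elim (fun i => Term.var i) (fun j => (L.con (a j)).term))

/-- A (complete) global type in the variables `x = (x_0, ..., x_{m-1})` : a maximal
finitely realized set of `L(U)`-formulas. -/
def IsGlobalType {m : ℕ} (p : Set ((L[[U]]).Formula (Fin m))) : Prop :=
  (∀ s : Finset ((L[[U]]).Formula (Fin m)), ↑s ⊆ p →
    ∃ b : Fin m → U, ∀ φ ∈ s, FRealize U (addAllConsts U iS) φ b) ∧
  ∀ φ : (L[[U]]).Formula (Fin m), φ ∈ p ↔ φ.not ∉ p

/-- `D` is externally definable: `D = {a : φ(x,a) ∈ p}` for some global type `p` and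
formula `φ(x,z)`. -/
def ExtDefinable {n : ℕ} (D : Set (Fin n → U)) : Prop :=
  ∃ (m : ℕ) (φ : L.Formula (Fin m ⊕ Fin n)) (p : Set ((L[[U]]).Formula (Fin m))),
    IsGlobalType L U p ∧ D = {a | instFormula L U φ a ∈ p}

/-- A sequence of `n`-tuples is indiscernible with respect to the formulas of a
structure `S` on `U`. -/
def IndiscIn {L' : FirstOrder.Language.{u, u}} (S : L'.Structure U) {n : ℕ} {I : Type*} [LinearOrder I]
    (a : I → Fin n → U) : Prop :=
  ∀ (k : ℕ) (i j : Fin k → I), StrictMono i → StrictMono j →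
    ∀ φ : L'.Formula (Fin k × Fin n),
      FRealize U S φ (fun q => a (i q.1) q.2) ↔ FRealize U S φ (fun q => a (j q.1) q.2)

/-- An `A`-indiscernible sequence of `n`-tuples. -/
def IndiscOver {n : ℕ} (A : Set U) {I : Type*} [LinearOrder I] (a : I → Fin n → U) : Prop :=
  IndiscIn U (addConsts U iS A) a


/-- `D` is Lascar invariant over `A` : `D` is invariant over every small model containing `A`. -/
def LascarInv {n : ℕ} (A : Set U) (D : Set (Fin n → U)) : Prop :=
  ∀ M : L.ElementarySubstructure U, A ⊆ (M : L.Substructure U) →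
    #((M : L.Substructure U) : Set U) < #U →
    ∀ f ∈ AutFix L U ((M : L.Substructure U) : Set U), imgSet L U f D = D

/-- The cardinality of the set `L(A)` of formulas with parameters in `A`. -/
def formulaCard (A : Set U) : Cardinal.{u} :=
  #(Σ k : ℕ, (L[[↥A]]).Formula (Fin k))

/-- `u` locally covers `B` (relative to the cardinal `κ`). -/
def LocallyCovers {α : Type u} (κ : Cardinal.{u}) (u : Set (Set α)) (B : Set α) : Prop :=
  ∀ K : Set α, K ⊆ B → #K = κ → ∀ k : ℕ, ∃ D ∈ u, (k : Cardinal.{u}) ≤ #(↥(K ∩ D))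

/-- `φ(x, b)` divides over `A` : for some infinite `K ⊆ o(b/A)` and some `k`,
`{φ(x,c) : c ∈ K}` is `k`-inconsistent. -/
def Divides {m n : ℕ} (φ : L.Formula (Fin m ⊕ Fin n)) (b : Fin n → U) (A : Set U) : Prop :=
  ∃ K : Set (Fin n → U), K ⊆ oTuple L U A b ∧ K.Infinite ∧
    ∃ k : ℕ, ∀ s : Finset (Fin n → U), ↑s ⊆ K → s.card = k →
      ¬∃ x : Fin m → U, ∀ c ∈ s, φ.Realize (Sum.elim x c)

/-- `C` is pseudo-invariant over `A` : `e(C)` locally covers `o(b/A)` for every `b ∈ C`. -/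
def PseudoInv {k : ℕ} (A : Set U) (C : Set (Fin k → U)) : Prop :=
  ∀ b ∈ C, LocallyCovers (#U) (eSet L U (∅ : Set U) C) (oTuple L U A b)

/-- A family `u` of subsets of `U^n` is closed: it is cut out by a set of sentences with a
second-order variable, i.e. sentences of the language expanded by a predicate. -/
def ClosedFam {n : ℕ} (u : Set (Set (Fin n → U))) : Prop :=
  ∃ p : Set ((expLang L n).Sentence),
    u = {D | ∀ φ ∈ p, SentRealize U (expStr L U D) φ}

/-- `κ` is a Ramsey cardinal : every `2`-coloring of the finite subsets of a set of size `κ`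
has a homogeneous set of size `κ`. -/
def IsRamseyCard (κ : Cardinal.{u}) : Prop :=
  ∀ (X : Type u), #X = κ → ∀ c : Finset X → Bool,
    ∃ H : Set X, #H = κ ∧
      ∀ s t : Finset X, ↑s ⊆ H → ↑t ⊆ H → s.card = t.card → c s = c t

/-- The formula `φ(x,z)` is NIP: the family of its instances `φ(a,U)` has finite
VC dimension. -/
def FormulaNIP {m n : ℕ} (φ : L.Formula (Fin m ⊕ Fin n)) : Prop :=
  FiniteVC {E : Set (Fin n → U) | ∃ b : Fin m → U, E = phiSet L U φ b}

/-- The theory of `U` is NIP: every formula is NIP. -/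
def TheoryNIP : Prop :=
  ∀ (m n : ℕ) (φ : L.Formula (Fin m ⊕ Fin n)), FormulaNIP L U φ

/-- A global type `p(z)` is invariant over `A` : each of the sets `D_{p,φ}` is fixed
(setwise) by every automorphism fixing `A` pointwise. -/
def GlobalTypeInv {n : ℕ} (A : Set U) (p : Set ((L[[U]]).Formula (Fin n))) : Prop :=
  ∀ (k : ℕ) (φ : L.Formula (Fin n ⊕ Fin k)) (f : U ≃[L] U), f ∈ AutFix L U A →
    imgSet L U f {a | instFormula L U φ a ∈ p} = {a | instFormula L U φ a ∈ p}

/-- `M` (a subset of `U`) is `L(A;C)`-saturated : every finitely realized type `p(x) ⊆ L(A;C)`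
is realized by a tuple from `M`. -/
def LACSat {n : ℕ} (C : Set (Fin n → U)) (A : Set U) (M : Set U) : Prop :=
  ∀ (m : ℕ) (p : Set (((expLang L n)[[↥A]]).Formula (Fin m))),
    (∀ s : Finset (((expLang L n)[[↥A]]).Formula (Fin m)), ↑s ⊆ p →
      ∃ b : Fin m → U, ∀ φ ∈ s, FRealize U (addConsts U (expStr L U C) A) φ b) →
    ∃ b : Fin m → U, (∀ i, b i ∈ M) ∧
      ∀ φ ∈ p, FRealize U (addConsts U (expStr L U C) A) φ b

/-- The inclusion of languages `L(M) → L(U)` for `M : Set U`. -/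
def liftConsts (M : Set U) : (L[[↥M]]) →ᴸ (L[[U]]) :=
  LHom.sumMap (LHom.id L) (LHom.constantsOnMap Subtype.val)


section Homogeneity

theorem fRealize_addConsts_constantsVarsEquiv_symm {L : FirstOrder.Language.{u, u}} {U : Type u}
    (S : L.Structure U) (B : Set U) {α : Type*} (φ : L.Formula (↥B ⊕ α)) (b : α → U) :
    FRealize U (addConsts U S B) (BoundedFormula.constantsVarsEquiv.symm φ) b ↔
      FRealize U S φ (Sum.elim (↑) b) := by
  have h := BoundedFormula.realize_constantsVarsEquiv (L := L) (α := ↥B) (M := U)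
    (φ := BoundedFormula.constantsVarsEquiv.symm φ) (v := b) (xs := default)
  rw [Equiv.apply_symm_apply] at h
  exact h.symm

/-- Saturation, with parameters given by a small indexed family. -/
theorem IsSatStr.exists_realize {L : FirstOrder.Language.{u, u}} {U : Type u} {S : L.Structure U} (h : IsSatStr U S) {ι : Type u}
    (hι : #ι < #U) (e : ι → U) {m : ℕ} (p : Set (L.Formula (ι ⊕ Fin m)))
    (hp : ∀ s : Finset (L.Formula (ι ⊕ Fin m)), ↑s ⊆ p →
      ∃ b : Fin m → U, ∀ φ ∈ s, φ.Realize (Sum.elim e b)) :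
    ∃ b : Fin m → U, ∀ φ ∈ p, φ.Realize (Sum.elim e b) := by
  classical
  let B : Set U := Set.range e
  let t : L.Formula (ι ⊕ Fin m) → (L[[↥B]]).Formula (Fin m) := fun φ =>
    BoundedFormula.constantsVarsEquiv.symm (φ.relabel (Sum.map (Set.rangeFactorization e) id))
  have key : ∀ (φ : L.Formula (ι ⊕ Fin m)) (b : Fin m → U),
      FRealize U (addConsts U S B) (t φ) b ↔ φ.Realize (Sum.elim e b) := by
    intro φ b
    refine (fRealize_addConsts_constantsVarsEquiv_symm S B _ b).trans ?_
    rw [FRealize, Formula.realize_relabel, Sum.elim_comp_map]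
    rfl
  obtain ⟨b, hb⟩ := h B (mk_range_le.trans_lt hι) m (t '' p) (by
    intro s hs
    obtain ⟨s', hs', rfl⟩ := Finset.subset_set_image_iff.1 hs
    obtain ⟨b, hb⟩ := hp s' hs'
    exact ⟨b, by simpa [key] using hb⟩)
  exact ⟨b, fun φ hφ => (key φ b).1 (hb _ ⟨φ, hφ, rfl⟩)⟩

variable {L : FirstOrder.Language.{u, u}} {U : Type u} [L.Structure U]

/-- A set of pairs whose two projections realize the same formulas. -/
def IsElemRel (L : FirstOrder.Language.{u, u}) {U : Type u} [L.Structure U]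
    (R : Set (U × U)) : Prop :=
  ∀ φ : L.Formula ↥R, φ.Realize (fun r => r.1.1) → φ.Realize (fun r => r.1.2)

theorem IsElemRel.iff_of_mem {R : Set (U × U)} (h : IsElemRel L R) {ι : Type*} {x y : ι → U}
    (hxy : ∀ i, (x i, y i) ∈ R) (φ : L.Formula ι) : φ.Realize x ↔ φ.Realize y := by
  have h' : ∀ φ : L.Formula ι, φ.Realize x → φ.Realize y := fun φ hφ => by
    have := h (φ.relabel fun i => ⟨(x i, y i), hxy i⟩)
    rw [Formula.realize_relabel, Formula.realize_relabel] at this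
    exact this hφ
  exact ⟨h' φ, fun hy => by_contra fun hx => h' φ.not hx hy⟩

theorem isElemRel_range {ι : Type*} {x y : ι → U}
    (h : ∀ φ : L.Formula ι, φ.Realize x → φ.Realize y) :
    IsElemRel L (Set.range fun i => (x i, y i)) := by
  intro φ hφ
  choose g hg using fun r : Set.range (fun i => (x i, y i)) => r.2
  have := h (φ.relabel g)
  rw [Formula.realize_relabel, Formula.realize_relabel] at this
  have h1 : x ∘ g = fun r => r.1.1 := funext fun r => congrArg Prod.fst (hg r)
  have h2 : y ∘ g = fun r => r.1.2 := funext fun r => congrArg Prod.snd (hg r)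
  rw [h1, h2] at this
  exact this hφ

theorem isElemRel_union_range {R : Set (U × U)} {ι : Type*} {x y : ι → U}
    (h : ∀ φ : L.Formula (↥R ⊕ ι),
      φ.Realize (Sum.elim (fun r => r.1.1) x) → φ.Realize (Sum.elim (fun r => r.1.2) y)) :
    IsElemRel L (R ∪ Set.range fun i => (x i, y i)) := by
  convert isElemRel_range h using 1
  ext ⟨a, b⟩
  simp

theorem IsElemRel.swap {R : Set (U × U)} (h : IsElemRel L R) :
    IsElemRel L (Prod.swap ⁻¹' R) := fun φ hφ =>
  (h.iff_of_mem (x := fun r : ↥(Prod.swap ⁻¹' R) => r.1.2) (y := fun r => r.1.1)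
    (fun r => r.2) φ).2 hφ

theorem isElemRel_iUnion {ι : Type*} [Nonempty ι] {S : ι → Set (U × U)}
    (hS : Directed (· ⊆ ·) S) (h : ∀ i, IsElemRel L (S i)) : IsElemRel L (⋃ i, S i) := by
  classical
  intro φ hφ
  have hfin : (((φ.freeVarFinset.image Subtype.val : Finset (U × U))) : Set (U × U)) ⊆
      ⋃ i, S i := by
    intro x hx
    obtain ⟨y, -, rfl⟩ := Finset.mem_image.1 (Finset.mem_coe.1 hx)
    exact y.2
  obtain ⟨i, hi⟩ := hS.exists_mem_subset_of_finset_subset_biUnion hfin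
  have hmem : ∀ a : φ.freeVarFinset, a.1.1 ∈ S i := fun a =>
    hi (Finset.mem_coe.2 (Finset.mem_image_of_mem _ a.2))
  have := (h i).iff_of_mem (x := fun a : φ.freeVarFinset => a.1.1.1) (y := fun a => a.1.1.2)
    hmem (φ.restrictFreeVar id)
  have h1 : ∀ p : U × U → U, Formula.Realize (φ.restrictFreeVar id)
      (fun a : φ.freeVarFinset => p a.1.1) ↔ φ.Realize fun r => p r.1 := fun p =>
    BoundedFormula.realize_restrictFreeVar _ fun _ => rfl
  exact (h1 Prod.snd).1 (this.1 ((h1 Prod.fst).2 hφ))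

theorem IsElemRel.exists_forth (hsat : IsSatStr U ‹L.Structure U›) {R : Set (U × U)}
    (h : IsElemRel L R) (hR : #R < #U) (u : U) : ∃ w, IsElemRel L (R ∪ {(u, w)}) := by
  classical
  obtain ⟨b, hb⟩ := hsat.exists_realize hR (fun r => r.1.2)
    {φ : L.Formula (↥R ⊕ Fin 1) | φ.Realize (Sum.elim (fun r => r.1.1) fun _ => u)} (by
    intro s hs
    have := (h.iff_of_mem (fun r : ↥R => r.2)
      (Formula.iExs (Fin 1) (Formula.iInf fun φ : s => φ.1))).1 (by
        rw [Formula.realize_iExs]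
        refine ⟨fun _ => u, ?_⟩
        rw [Formula.realize_iInf]
        exact fun φ => hs φ.2)
    obtain ⟨b, hb⟩ := Formula.realize_iExs.1 this
    rw [Formula.realize_iInf] at hb
    exact ⟨b, fun φ hφ => hb ⟨φ, hφ⟩⟩)
  refine ⟨b 0, ?_⟩
  have : ({(u, b 0)} : Set (U × U)) = Set.range fun i : Fin 1 => (u, b i) := by
    ext x; simp [eq_comm]
  rw [this]
  exact isElemRel_union_range fun φ hφ => hb φ hφ

theorem IsElemRel.exists_back_and_forth (hsat : IsSatStr U ‹L.Structure U›)
    (hU : ℵ₀ ≤ #U) {R : Set (U × U)}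
    (h : IsElemRel L R) (hR : #R < #U) (u : U) :
    ∃ w w', IsElemRel L (R ∪ {(u, w), (w', u)}) := by
  obtain ⟨w, hw⟩ := h.exists_forth hsat hR u
  have hcard : #↥(Prod.swap ⁻¹' (R ∪ {(u, w)})) < #U := by
    rw [mk_preimage_of_injective_of_subset_range _ _ Prod.swap_injective
      (fun x _ => ⟨x.swap, by simp⟩)]
    refine (mk_union_le _ _).trans_lt (add_lt_of_lt hU hR ?_)
    rw [mk_singleton]
    exact one_lt_aleph0.trans_le hU
  obtain ⟨w', hw'⟩ := hw.swap.exists_forth hsat hcard u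
  refine ⟨w, w', ?_⟩
  convert hw'.swap using 1
  ext ⟨a, b⟩
  simp only [Set.mem_union, Set.mem_insert_iff, Set.mem_singleton_iff, Set.mem_preimage,
    Prod.swap_prod_mk, Prod.mk.injEq]
  tauto

/-- Saturated structures are strongly homogeneous. -/
theorem IsElemRel.exists_equiv (hsat : IsSatStr U ‹L.Structure U›) (hU : ℵ₀ ≤ #U)
    {R : Set (U × U)} (h : IsElemRel L R) (hR : #R < #U) :
    ∃ f : U ≃[L] U, ∀ x y, (x, y) ∈ R → f x = y := by
  classical
  obtain ⟨r, hwo, hr⟩ := exists_ord_eq U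
  have hseg : ∀ u, #{v | r v u} < #U := fun u => by
    have := card_typein_lt u hr
    rwa [Ordinal.card_typein] at this
  have hex : ∀ (R : Set (U × U)) (u : U), ∃ w w', IsElemRel L R → #R < #U →
      IsElemRel L (R ∪ {(u, w), (w', u)}) := by
    intro R u
    by_cases hc : IsElemRel L R ∧ #R < #U
    · obtain ⟨w, w', hw⟩ := hc.1.exists_back_and_forth hsat hU hc.2 u
      exact ⟨w, w', fun _ _ => hw⟩
    · exact ⟨u, u, fun h1 h2 => (hc ⟨h1, h2⟩).elim⟩
  choose g g' hg using hex
  let new : U → Set (U × U) := hwo.wf.fix fun u ih =>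
    let P := R ∪ ⋃ v : {v // r v u}, ih v.1 v.2
    {(u, g P u), (g' P u, u)}
  let P : U → Set (U × U) := fun u => R ∪ ⋃ v : {v // r v u}, new v.1
  have hnew : ∀ u, new u = {(u, g (P u) u), (g' (P u) u, u)} := fun u => hwo.wf.fix_eq _ u
  have hPcard : ∀ u, #(P u) < #U := by
    intro u
    refine (mk_union_le _ _).trans_lt (add_lt_of_lt hU hR ?_)
    refine (mk_iUnion_le_sum_mk).trans_lt ?_
    refine (sum_le_sum _ (fun _ => (2 : Cardinal)) fun v => ?_).trans_lt ?_
    · rw [hnew]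
      refine (mk_insert_le).trans ?_
      rw [mk_singleton, one_add_one_eq_two]
    · rw [sum_const, lift_id, lift_id]
      exact mul_lt_of_lt hU (hseg u) ((natCast_lt_aleph0 (n := 2)).trans_le hU)
  let Q : U → Set (U × U) := fun u => P u ∪ new u
  have hPQ : ∀ {v u}, r v u → Q v ⊆ P u := by
    rintro v u hvu x ((hx | hx) | hx)
    · exact Or.inl hx
    · obtain ⟨w, hw⟩ := Set.mem_iUnion.1 hx
      exact Or.inr (Set.mem_iUnion.2 ⟨⟨w.1, _root_.trans w.2 hvu⟩, hw⟩)
    · exact Or.inr (Set.mem_iUnion.2 ⟨⟨v, hvu⟩, hx⟩)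
  have hQmono : ∀ {v u}, r v u → Q v ⊆ Q u := fun hvu => (hPQ hvu).trans Set.subset_union_left
  have hQdir : Directed (· ⊆ ·) Q := by
    intro v u
    rcases trichotomous_of r v u with hvu | rfl | huv
    · exact ⟨u, hQmono hvu, subset_rfl⟩
    · exact ⟨v, subset_rfl, subset_rfl⟩
    · exact ⟨v, subset_rfl, hQmono huv⟩
  have hQ : ∀ u, IsElemRel L (Q u) := by
    intro u
    induction u using hwo.wf.induction with
    | _ u ih =>
    have hP : IsElemRel L (P u) := by
      by_cases hne : Nonempty {v // r v u}
      · have : P u = ⋃ v : {v // r v u}, Q v.1 := by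
          refine Set.Subset.antisymm ?_ (Set.iUnion_subset fun v => hPQ v.2)
          rintro x (hx | hx)
          · exact Set.mem_iUnion.2 ⟨hne.some, Or.inl (Or.inl hx)⟩
          · obtain ⟨v, hv⟩ := Set.mem_iUnion.1 hx
            exact Set.mem_iUnion.2 ⟨v, Or.inr hv⟩
        rw [this]
        refine isElemRel_iUnion (fun v w => ?_) fun v => ih v.1 v.2
        rcases trichotomous_of r v.1 w.1 with hvu | he | huv
        · exact ⟨w, hQmono hvu, subset_rfl⟩
        · exact ⟨v, subset_rfl, by rw [he]⟩
        · exact ⟨v, subset_rfl, hQmono huv⟩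
      · rw [not_nonempty_iff] at hne
        simpa [P] using h
    change IsElemRel L (P u ∪ new u)
    rw [hnew]
    exact hg _ _ hP (hPcard u)
  have : Nonempty U := mk_ne_zero_iff.1 (aleph0_pos.trans_le hU).ne'
  have hT := isElemRel_iUnion hQdir hQ
  have hmem : ∀ u, ∀ x ∈ new u, x ∈ ⋃ u, Q u := fun u x hx => Set.mem_iUnion.2 ⟨u, Or.inr hx⟩
  let f : U → U := fun u => g (P u) u
  have hf : ∀ u, (u, f u) ∈ ⋃ u, Q u := fun u => hmem u _ (by simp [hnew, f])
  have hfun : ∀ {x y}, (x, y) ∈ ⋃ u, Q u → f x = y := by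
    intro x y hxy
    have := (hT.iff_of_mem (x := ![x, x]) (y := ![f x, y])
      (by intro i; fin_cases i; exacts [hf x, hxy])
      (Term.equal (Term.var 0) (Term.var 1))).1 (by simp)
    simpa using this
  let F : U ↪ₑ[L] U := ⟨f, fun k φ x => (hT.iff_of_mem (fun i => hf (x i)) φ).symm⟩
  have hsurj : Function.Surjective f := fun u =>
    ⟨g' (P u) u, hfun (hmem u _ (by simp [hnew]))⟩
  exact ⟨{ Equiv.ofBijective f ⟨F.injective, hsurj⟩ with
      map_fun' := F.map_fun
      map_rel' := F.map_rel },
    fun x y hxy => hfun (Set.mem_iUnion.2 ⟨Classical.arbitrary U, Or.inl (Or.inl hxy)⟩)⟩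

end Homogeneity

section Expansion

/-- The formula of the expanded language saying that a tuple of variables is in the predicate. -/
def predFormula (L : FirstOrder.Language.{u, u}) {n : ℕ} {α : Type*} (x : Fin n → α) :
    (expLang L n).Formula α :=
  Relations.formula (L := expLang L n) (Sum.inr ⟨⟨rfl⟩⟩) fun i => Term.var (x i)

variable {L : FirstOrder.Language.{u, u}} {U : Type u} [iS : L.Structure U]

theorem fRealize_predFormula {n : ℕ} (D : Set (Fin n → U)) {α : Type*} (x : Fin n → α)
    (v : α → U) : FRealize U (expStr L U D) (predFormula L x) v ↔ v ∘ x ∈ D := by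
  let := expStr L U D
  exact Formula.realize_rel

/-- A formula of the base language as a formula of the expanded language. -/
def expFormula {n : ℕ} {α : Type*} (φ : L.Formula α) : (expLang L n).Formula α :=
  (LHom.sumInl : L →ᴸ L.sum (predLang n)).onFormula φ

theorem fRealize_expFormula {n : ℕ} (D : Set (Fin n → U)) {α : Type*} (φ : L.Formula α)
    (v : α → U) : FRealize U (expStr L U D) (expFormula φ) v ↔ φ.Realize v := by
  let : (L.sum (predLang n)).Structure U := expStr L U D
  have : (LHom.sumInl : L →ᴸ L.sum (predLang n)).IsExpansionOn U :=
    ⟨fun _ _ => rfl, fun _ _ => rfl⟩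
  exact LHom.realize_onFormula (LHom.sumInl : L →ᴸ L.sum (predLang n)) φ

theorem LACSat.exists_mem_forall_realize {n : ℕ} {C : Set (Fin n → U)} {A M : Set U}
    (h : LACSat L U C A M) {m : ℕ} (b : Fin m → U) :
    ∃ b' : Fin m → U, (∀ i, b' i ∈ M) ∧ ∀ φ : (expLang L n).Formula (↥A ⊕ Fin m),
      FRealize U (expStr L U C) φ (Sum.elim (↑) b) →
        FRealize U (expStr L U C) φ (Sum.elim (↑) b') := by
  obtain ⟨b', hb', hφ⟩ := h m {φ | FRealize U (addConsts U (expStr L U C) A) φ b}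
    fun s hs => ⟨b, fun φ hφ => hs hφ⟩
  refine ⟨b', hb', fun φ h => ?_⟩
  rw [← fRealize_addConsts_constantsVarsEquiv_symm] at h ⊢
  exact hφ _ h

end Expansion

section Separation

variable {L : FirstOrder.Language.{u, u}} {U : Type u} [iS : L.Structure U]

theorem definable_setOf_realize {B : Set U} {ι α : Type*} {e : ι → U} (he : ∀ i, e i ∈ B)
    (φ : L.Formula (ι ⊕ α)) : B.Definable L {z | φ.Realize (Sum.elim e z)} := by
  rw [definable_iff_exists_formula_sum]
  refine ⟨φ.relabel (Sum.map (fun i => ⟨e i, he i⟩) id), ?_⟩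
  ext z
  simp only [Set.mem_ofPred_eq, Formula.realize_relabel, Sum.elim_comp_map]
  rfl

theorem definable_singleton_tuple {B : Set U} {n : ℕ} {c : Fin n → U} (hc : ∀ i, c i ∈ B) :
    B.Definable L {c} := by
  convert definable_setOf_realize hc (Formula.iInf fun i : Fin n =>
    Term.equal (L := L) (Term.var (Sum.inl i)) (Term.var (Sum.inr i))) using 1
  ext z
  simp [Formula.realize_iInf, funext_iff, eq_comm]

/-- The parameters available at step `i` of a sequence `c` of tuples built over `A`. -/
def seqParams (A : Set U) {n : ℕ} (c : ℕ → Fin n → U) (i : ℕ) : Set U :=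
  A ∪ ⋃ j : Fin i, Set.range (c j)

theorem seqParams_succ (A : Set U) {n : ℕ} (c : ℕ → Fin n → U) (i : ℕ) :
    seqParams A c (i + 1) = seqParams A c i ∪ Set.range (c i) := by
  ext x
  simp only [seqParams, Set.mem_union, Set.mem_iUnion, Fin.exists_fin_succ', Fin.val_castSucc,
    Fin.val_last, or_assoc]

/-- A sequence of tuples each of which is generic for `F` over `A` and its predecessors. -/
def IsGenericSeq (L : FirstOrder.Language.{u, u}) {U : Type u} [L.Structure U] {n : ℕ}
    (F : Ultrafilter (Fin n → U)) (A : Set U) (c : ℕ → Fin n → U) : Prop :=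
  ∀ i, ∀ S ∈ F, (seqParams A c i).Definable L S → c i ∈ S

/-- The correspondence matching the first `k` terms of two sequences over `A`. -/
def seqRel (A : Set U) {n : ℕ} (c c' : ℕ → Fin n → U) (k : ℕ) : Set (U × U) :=
  Set.range (fun a : A => ((a : U), (a : U))) ∪
    ⋃ j : Fin k, Set.range fun l => (c j l, c' j l)

theorem seqRel_succ (A : Set U) {n : ℕ} (c c' : ℕ → Fin n → U) (k : ℕ) :
    seqRel A c c' (k + 1) = seqRel A c c' k ∪ Set.range fun l => (c k l, c' k l) := by
  ext p
  simp only [seqRel, Set.mem_union, Set.mem_iUnion, Fin.exists_fin_succ', Fin.val_castSucc,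
    Fin.val_last, or_assoc]

theorem IsGenericSeq.isElemRel_seqRel {n : ℕ} {F : Ultrafilter (Fin n → U)} {A : Set U}
    (hF : tuplesIn U A ∈ F) {c c' : ℕ → Fin n → U} (hc : IsGenericSeq L F A c)
    (hc' : IsGenericSeq L F A c') (k : ℕ) : IsElemRel L (seqRel A c c' k) := by
  induction k with
  | zero =>
    have : seqRel A c c' 0 = Set.range (fun a : A => ((a : U), (a : U))) := by simp [seqRel]
    rw [this]
    exact isElemRel_range fun φ h => h
  | succ k ih =>
    rw [seqRel_succ]
    refine isElemRel_union_range fun φ hφ => ?_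
    have hfst : ∀ r : seqRel A c c' k, r.1.1 ∈ seqParams A c k := by
      rintro ⟨_, ⟨a, rfl⟩ | hr⟩
      · exact Or.inl a.2
      · obtain ⟨j, l, rfl⟩ := Set.mem_iUnion.1 hr
        exact Or.inr (Set.mem_iUnion.2 ⟨j, l, rfl⟩)
    have hsnd : ∀ r : seqRel A c c' k, r.1.2 ∈ seqParams A c' k := by
      rintro ⟨_, ⟨a, rfl⟩ | hr⟩
      · exact Or.inl a.2
      · obtain ⟨j, l, rfl⟩ := Set.mem_iUnion.1 hr
        exact Or.inr (Set.mem_iUnion.2 ⟨j, l, rfl⟩)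
    have h1 : {z | φ.Realize (Sum.elim (fun r => r.1.1) z)} ∈ F := by
      by_contra hn
      exact hc k _ (Ultrafilter.compl_mem_iff_notMem.2 hn)
        (definable_setOf_realize hfst φ).compl hφ
    refine hc' k _ ?_ (definable_setOf_realize hsnd φ)
    filter_upwards [h1, hF] with z hz hzA
    refine (ih.iff_of_mem ?_ φ).1 hz
    rintro (r | i)
    · exact r.2
    · exact Or.inl ⟨⟨z i, hzA i⟩, rfl⟩

theorem mk_iUnion_range_fin_lt (hU : ℵ₀ ≤ #U) {V : Type u} {k n : ℕ} (c : Fin k → Fin n → V) :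
    #(⋃ j, Set.range (c j)) < #U :=
  ((Set.finite_iUnion fun j => Set.finite_range (c j)).lt_aleph0).trans_le hU

theorem SatSet.exists_generic {n : ℕ} {C : Set (Fin n → U)} (hC : SatSet L U C)
    {F : Ultrafilter (Fin n → U)}
    (hF : ∀ S ∈ F, (Set.univ : Set U).Definable L S → (S ∩ C).Nonempty ∧ (S ∩ Cᶜ).Nonempty)
    {B : Set U} (hB : #B < #U) (ε : Prop) :
    ∃ c : Fin n → U, (c ∈ C ↔ ε) ∧ ∀ S ∈ F, B.Definable L S → c ∈ S := by
  classical
  obtain ⟨c, hc⟩ := IsSatStr.exists_realize hC hB (fun b => (b : U))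
    {φ : (expLang L n).Formula (↥B ⊕ Fin n) | ∃ S ∈ F, (Set.univ : Set U).Definable L S ∧
      ∀ v ∈ S, (v ∈ C ↔ ε) → FRealize U (expStr L U C) φ (Sum.elim (↑) v)} (by
    intro s hs
    obtain ⟨S, hSF, hSd, hS⟩ : ∃ S ∈ F, (Set.univ : Set U).Definable L S ∧
        ∀ v ∈ S, (v ∈ C ↔ ε) → ∀ φ ∈ s, FRealize U (expStr L U C) φ (Sum.elim (↑) v) := by
      choose T hTF hTd hT using fun φ : s => hs φ.2
      exact ⟨⋂ φ, T φ, Filter.iInter_mem.2 hTF, definable_iInter_of_finite hTd,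
        fun v hv hε φ hφ => hT ⟨φ, hφ⟩ v (Set.mem_iInter.1 hv _) hε⟩
    obtain ⟨⟨x, hxS, hx⟩, y, hyS, hy⟩ := hF S hSF hSd
    by_cases hε : ε
    · exact ⟨x, hS x hxS (iff_of_true hx hε)⟩
    · exact ⟨y, hS y hyS (iff_of_false hy hε)⟩)
  change ∀ φ ∈ _, FRealize U (expStr L U C) φ _ at hc
  refine ⟨c, ?_, fun S hSF hS => ?_⟩
  · have hp : ∀ v : Fin n → U, FRealize U (expStr L U C)
        (predFormula L (Sum.inr : Fin n → ↥B ⊕ Fin n)) (Sum.elim (↑) v) ↔ v ∈ C := fun v =>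
      fRealize_predFormula C _ _
    by_cases hε : ε
    · refine iff_of_true ((hp c).1 (hc _ ?_)) hε
      exact ⟨_, Filter.univ_mem, definable_univ, fun v _ hv => (hp v).2 (hv.2 hε)⟩
    · refine iff_of_false (fun h => hc (predFormula L Sum.inr).not ?_ ((hp c).2 h)) hε
      exact ⟨_, Filter.univ_mem, definable_univ, fun v _ hv h => hε (hv.1 ((hp v).1 h))⟩
  · obtain ⟨φ, rfl⟩ := definable_iff_exists_formula_sum.1 hS
    exact (fRealize_expFormula C φ _).1 (hc _ ⟨_, hSF, hS.mono (Set.subset_univ B),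
      fun v hv _ => (fRealize_expFormula C φ _).2 hv⟩)

theorem SatSet.exists_isGenericSeq (hU : ℵ₀ ≤ #U) {n : ℕ} {C : Set (Fin n → U)}
    (hC : SatSet L U C) {F : Ultrafilter (Fin n → U)}
    (hF : ∀ S ∈ F, (Set.univ : Set U).Definable L S → (S ∩ C).Nonempty ∧ (S ∩ Cᶜ).Nonempty)
    {A : Set U} (hA : #A < #U) (η : ℕ → Prop) :
    ∃ c : ℕ → Fin n → U, IsGenericSeq L F A c ∧ ∀ i, c i ∈ C ↔ η i := by
  classical
  have hex : ∀ (B : Set U) (ε : Prop), ∃ c : Fin n → U, #B < #U →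
      (c ∈ C ↔ ε) ∧ ∀ S ∈ F, B.Definable L S → c ∈ S := by
    intro B ε
    by_cases hB : #B < #U
    · obtain ⟨c, hc⟩ := hC.exists_generic hF hB ε
      exact ⟨c, fun _ => hc⟩
    · obtain ⟨x, -⟩ := (hF _ Filter.univ_mem definable_univ).1
      exact ⟨x, fun h => (hB h).elim⟩
  choose g hg using hex
  let B : ℕ → Set U := fun i => Nat.rec A (fun i B => B ∪ Set.range (g B (η i))) i
  have hB : ∀ i, B i = seqParams A (fun j => g (B j) (η j)) i := by
    intro i
    induction i with
    | zero => simp [B, seqParams]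
    | succ i ih =>
      rw [seqParams_succ, ← ih]
  have hcard : ∀ i, #↥(B i) < #U := fun i => by
    rw [hB i]
    exact (mk_union_le _ _).trans_lt (add_lt_of_lt hU hA (mk_iUnion_range_fin_lt hU _))
  exact ⟨fun i => g (B i) (η i), fun i S hS hd => (hg _ _ (hcard i)).2 S hS (by rwa [hB i]),
    fun i => (hg _ _ (hcard i)).1⟩

/-- A saturated set with orbit of finite VC dimension is separated from its complement on `A`
by definable sets. -/
theorem SatSet.exists_definable_separation (hsat : IsSatStr U iS) (hU : ℵ₀ ≤ #U) {n : ℕ}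
    {C : Set (Fin n → U)} {A : Set U} (hA : #A < #U) (hC : SatSet L U C)
    (hvc : FiniteVC (oSet L U A C)) :
    ∃ S₀ S₁ : Set (Fin n → U), (Set.univ : Set U).Definable L S₀ ∧
      (Set.univ : Set U).Definable L S₁ ∧ S₀ ⊆ C ∧ S₁ ⊆ Cᶜ ∧ tuplesIn U A ⊆ S₀ ∪ S₁ := by
  classical
  by_contra hcon
  let G : Filter (Fin n → U) :=
    { sets := {X | ∃ S₀ S₁ : Set (Fin n → U), (Set.univ : Set U).Definable L S₀ ∧
        (Set.univ : Set U).Definable L S₁ ∧ S₀ ⊆ C ∧ S₁ ⊆ Cᶜ ∧ tuplesIn U A ⊆ X ∪ (S₀ ∪ S₁)}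
      univ_sets := ⟨∅, ∅, definable_empty, definable_empty, by simp, by simp, by simp⟩
      sets_of_superset := by
        rintro X Y ⟨S₀, S₁, h₀, h₁, hC₀, hC₁, h⟩ hXY
        exact ⟨S₀, S₁, h₀, h₁, hC₀, hC₁, h.trans (Set.union_subset_union_left _ hXY)⟩
      inter_sets := by
        rintro X Y ⟨S₀, S₁, h₀, h₁, hC₀, hC₁, h⟩ ⟨T₀, T₁, k₀, k₁, kC₀, kC₁, k⟩
        refine ⟨S₀ ∪ T₀, S₁ ∪ T₁, h₀.union k₀, h₁.union k₁, Set.union_subset hC₀ kC₀,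
          Set.union_subset hC₁ kC₁, fun x hx => ?_⟩
        have hx₁ := h hx
        have hx₂ := k hx
        simp only [Set.mem_union, Set.mem_inter_iff] at hx₁ hx₂ ⊢
        tauto }
  have hGA : tuplesIn U A ∈ G :=
    ⟨∅, ∅, definable_empty, definable_empty, by simp, by simp, by simp⟩
  have hG₀ : ∀ S, (Set.univ : Set U).Definable L S → S ⊆ C → Sᶜ ∈ G := fun S hS hSC =>
    ⟨S, ∅, hS, definable_empty, hSC, by simp, by simp⟩
  have hG₁ : ∀ S, (Set.univ : Set U).Definable L S → S ⊆ Cᶜ → Sᶜ ∈ G := fun S hS hSC =>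
    ⟨∅, S, definable_empty, hS, by simp, hSC, by simp⟩
  have : G.NeBot := by
    rw [← Filter.empty_mem_iff_bot.not.trans Filter.neBot_iff.symm]
    rintro ⟨S₀, S₁, h₀, h₁, hC₀, hC₁, h⟩
    exact hcon ⟨S₀, S₁, h₀, h₁, hC₀, hC₁, by simpa using h⟩
  let F := Ultrafilter.of G
  have hGF : ∀ {S}, S ∈ G → S ∈ F := fun h => Ultrafilter.of_le G h
  have hF : ∀ S ∈ F, (Set.univ : Set U).Definable L S →
      (S ∩ C).Nonempty ∧ (S ∩ Cᶜ).Nonempty := by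
    intro S hS hd
    constructor <;> by_contra hne <;> rw [Set.not_nonempty_iff_eq_empty] at hne
    · exact Ultrafilter.compl_notMem_iff.2 hS
        (hGF (hG₁ S hd (Set.disjoint_left.1 (Set.disjoint_iff_inter_eq_empty.2 hne))))
    · refine Ultrafilter.compl_notMem_iff.2 hS (hGF (hG₀ S hd ?_))
      exact Set.disjoint_compl_right_iff_subset.1 (Set.disjoint_iff_inter_eq_empty.2 hne)
  have hseq := hC.exists_isGenericSeq hU hF hA
  obtain ⟨d, hd, -⟩ := hseq fun _ => True
  have hlt : ∀ i j, i < j → d i ≠ d j := by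
    intro i j hij he
    have hmem : ∀ l, d i l ∈ seqParams A d j := fun l =>
      Or.inr (Set.mem_iUnion.2 ⟨⟨i, hij⟩, l, rfl⟩)
    refine hd j {d i}ᶜ (hGF ?_) (definable_singleton_tuple hmem).compl he.symm
    have hs := definable_singleton_tuple (L := L) (fun l => Set.mem_univ (d i l))
    by_cases hi : d i ∈ C
    · exact hG₀ _ hs (Set.singleton_subset_iff.2 hi)
    · exact hG₁ _ hs (Set.singleton_subset_iff.2 hi)
  have hinj : Function.Injective d := fun i j he => by
    rcases lt_trichotomy i j with h | h | h
    exacts [(hlt i j h he).elim, h, (hlt j i h he.symm).elim]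
  obtain ⟨N, hN⟩ := hvc
  refine hN ((Finset.range N).image d)
    (by rw [Finset.card_image_of_injective _ hinj, Finset.card_range]) fun H hH => ?_
  obtain ⟨c, hc, hcC⟩ := hseq fun i => d i ∈ H
  obtain ⟨f, hf⟩ := (hc.isElemRel_seqRel (hGF hGA) hd N).exists_equiv hsat hU
    ((mk_union_le _ _).trans_lt (add_lt_of_lt hU (mk_range_le.trans_lt hA)
      ((Set.finite_iUnion fun j => Set.finite_range _).lt_aleph0.trans_le hU)))
  have hfc : ∀ i < N, f ∘ c i = d i := fun i hi => funext fun l =>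
    hf _ _ (Or.inr (Set.mem_iUnion.2 ⟨⟨i, hi⟩, l, rfl⟩))
  have hfC : ∀ i < N, d i ∈ imgSet L U f C ↔ d i ∈ H := by
    intro i hi
    rw [← hcC i]
    nth_rw 1 [← hfc i hi]
    refine ⟨?_, fun h => ⟨_, h, rfl⟩⟩
    rintro ⟨x, hx, he⟩
    rwa [← (f.injective.comp_left he : x = c i)]
  refine ⟨imgSet L U f C, ⟨f, fun a ha => hf _ _ (Or.inl ⟨⟨a, ha⟩, rfl⟩), rfl⟩, ?_⟩
  ext x
  constructor
  · rintro ⟨hx, hxB⟩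
    obtain ⟨i, hi, rfl⟩ := Finset.mem_image.1 (Finset.mem_coe.1 hxB)
    exact (hfC i (Finset.mem_range.1 hi)).1 hx
  · intro hx
    obtain ⟨i, hi, rfl⟩ := Finset.mem_image.1 (Finset.mem_coe.1 (hH hx))
    exact ⟨(hfC i (Finset.mem_range.1 hi)).2 hx, hH hx⟩

end Separation

/-- with `C` saturated, `o(C/A)` of finite VC dimension and `M ⪯ U` an
`L(A;C)`-saturated model, there are `M`-formulas `ψ₀, ψ₁` with `ψ₀(U) ⊆ C`, `ψ₁(U) ⊆ ¬C`
such that `q(z) ⊢ ψ₀(z) ∨ ψ₁(z)`, where `q(z) = {¬φ(z) : φ(z) ∈ L(M), φ(A) = ∅}`. -/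
theorem stmt7 (L : FirstOrder.Language.{u, u}) (U : Type u) [iS : L.Structure U]
    (hsat : IsSatStr U iS) (hinacc : Cardinal.IsInaccessible #U) (hcard : L.card < #U)
    (n : ℕ) (C : Set (Fin n → U)) (A : Set U) (hA : #A < #U)
    (hCsat : SatSet L U C) (hvc : FiniteVC (oSet L U A C))
    (M : L.ElementarySubstructure U) (hMsat : LACSat L U C A (M : Set U)) :
    ∃ ψ₀ ψ₁ : (L[[↥(M : Set U)]]).Formula (Fin n),
      {a : Fin n → U | FRealize U (addConsts U iS (M : Set U)) ψ₀ a} ⊆ C ∧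
      {a : Fin n → U | FRealize U (addConsts U iS (M : Set U)) ψ₁ a} ⊆ Cᶜ ∧
      ∀ a : Fin n → U,
        (∀ φ : (L[[↥(M : Set U)]]).Formula (Fin n),
          (∀ c : Fin n → U, (∀ i, c i ∈ A) → ¬FRealize U (addConsts U iS (M : Set U)) φ c) →
          FRealize U (addConsts U iS (M : Set U)) φ.not a) →
        (FRealize U (addConsts U iS (M : Set U)) ψ₀ a ∨
          FRealize U (addConsts U iS (M : Set U)) ψ₁ a) := by
  classical
  obtain ⟨S₀, S₁, h₀, h₁, hC₀, hC₁, hcov⟩ :=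
    hCsat.exists_definable_separation hsat hinacc.aleph0_lt.le hA hvc
  obtain ⟨s₀, -, h₀⟩ := definable_iff_finitely_definable.1 h₀
  obtain ⟨s₁, -, h₁⟩ := definable_iff_finitely_definable.1 h₁
  let b : Fin (s₀ ∪ s₁).card → U := fun i => ((s₀ ∪ s₁).equivFin.symm i : U)
  have hdef : ∀ (s : Finset U) (S : Set (Fin n → U)), s ⊆ s₀ ∪ s₁ → (s : Set U).Definable L S →
      ∃ φ : L.Formula (Fin (s₀ ∪ s₁).card ⊕ Fin n), S = {v | φ.Realize (Sum.elim b v)} := by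
    intro s S hs hS
    obtain ⟨φ, rfl⟩ := definable_iff_exists_formula_sum.1 hS
    refine ⟨φ.relabel (Sum.map (fun x => (s₀ ∪ s₁).equivFin ⟨x.1, hs x.2⟩) id), ?_⟩
    ext v
    simp only [Set.mem_ofPred_eq, Formula.realize_relabel, Sum.elim_comp_map]
    simp [b, Function.comp_def]
  obtain ⟨φ₀, rfl⟩ := hdef s₀ S₀ Finset.subset_union_left h₀
  obtain ⟨φ₁, rfl⟩ := hdef s₁ S₁ Finset.subset_union_right h₁
  obtain ⟨b', hb'M, hb'⟩ := hMsat.exists_mem_forall_realize b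
  let := expStr L U C
  let par : Fin (s₀ ∪ s₁).card ⊕ Fin n → (↥A ⊕ Fin (s₀ ∪ s₁).card) ⊕ Fin n :=
    Sum.map Sum.inr id
  have hexp : ∀ (φ : L.Formula (Fin (s₀ ∪ s₁).card ⊕ Fin n)) (x : Fin (s₀ ∪ s₁).card → U)
      (v : Fin n → U), (expFormula (n := n) (φ.relabel par)).Realize
        (Sum.elim (Sum.elim (Subtype.val : A → U) x) v) ↔ φ.Realize (Sum.elim x v) := by
    intro φ x v
    refine (fRealize_expFormula C _ _).trans ?_
    rw [Formula.realize_relabel, Sum.elim_comp_map]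
    rfl
  have hpred : ∀ (x : Fin (s₀ ∪ s₁).card → U) (v : Fin n → U),
      (predFormula L (Sum.inr : Fin n → (↥A ⊕ Fin (s₀ ∪ s₁).card) ⊕ Fin n)).Realize
        (Sum.elim (Sum.elim (Subtype.val : A → U) x) v) ↔ v ∈ C := fun x v =>
    fRealize_predFormula C _ _
  have hin : ∀ v, φ₀.Realize (Sum.elim b' v) → v ∈ C := by
    have := hb' (Formula.iAlls (Fin n) ((expFormula (φ₀.relabel par)).imp
      (predFormula L Sum.inr)))
    simp only [FRealize, Formula.realize_iAlls, Formula.realize_imp, hexp, hpred] at this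
    exact this fun v hv => hC₀ hv
  have hout : ∀ v, φ₁.Realize (Sum.elim b' v) → v ∉ C := by
    have := hb' (Formula.iAlls (Fin n) ((expFormula (φ₁.relabel par)).imp
      (predFormula L Sum.inr).not))
    simp only [FRealize, Formula.realize_iAlls, Formula.realize_imp, Formula.realize_not, hexp,
      hpred] at this
    exact this fun v hv => hC₁ hv
  have hA' : ∀ v ∈ tuplesIn U A,
      φ₀.Realize (Sum.elim b' v) ∨ φ₁.Realize (Sum.elim b' v) := by
    intro v hv
    let sub : Fin (s₀ ∪ s₁).card ⊕ Fin n → ↥A ⊕ Fin (s₀ ∪ s₁).card :=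
      Sum.elim Sum.inr fun i => Sum.inl ⟨v i, hv i⟩
    have hsub : ∀ x : Fin (s₀ ∪ s₁).card → U,
        Sum.elim (Subtype.val : A → U) x ∘ sub = Sum.elim x v := by
      intro x
      ext (i | i) <;> rfl
    have := hb' (expFormula ((φ₀ ⊔ φ₁).relabel sub))
    rw [fRealize_expFormula, fRealize_expFormula, Formula.realize_relabel,
      Formula.realize_relabel, hsub, hsub, Formula.realize_sup, Formula.realize_sup] at this
    exact this (hcov hv)
  let toM : L.Formula (Fin (s₀ ∪ s₁).card ⊕ Fin n) → (L[[↥(M : Set U)]]).Formula (Fin n) :=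
    fun φ => BoundedFormula.constantsVarsEquiv.symm
      (φ.relabel (Sum.map (fun i => (⟨b' i, hb'M i⟩ : ↥(M : Set U))) id))
  have htoM : ∀ φ v, FRealize U (addConsts U iS (M : Set U)) (toM φ) v ↔
      φ.Realize (Sum.elim b' v) := by
    intro φ v
    refine (fRealize_addConsts_constantsVarsEquiv_symm iS _ _ v).trans ?_
    rw [FRealize, Formula.realize_relabel, Sum.elim_comp_map]
    rfl
  refine ⟨toM φ₀, toM φ₁, fun v hv => hin v ((htoM _ _).1 hv),
    fun v hv => hout v ((htoM _ _).1 hv), fun a ha => ?_⟩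
  by_contra hcon
  rw [htoM, htoM] at hcon
  have hnot : ¬FRealize U (addConsts U iS (M : Set U)) (toM (φ₀ ⊔ φ₁).not) a := by
    intro hh
    refine ha (toM (φ₀ ⊔ φ₁).not) (fun c hc h => ?_) hh
    rw [htoM, Formula.realize_not, Formula.realize_sup] at h
    exact h (hA' c hc)
  rw [htoM, Formula.realize_not, Formula.realize_sup] at hnot
  exact hnot hcon

end Paper
end

section
/- Assume C ⊆ U^{|z|} is saturated and o(C/A) has finite VC-dimension for some small A ⊆ U. Then C is approximable from below and approximable from above. -/
namespace Paper

open FirstOrder Language Cardinal Set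

universe u

variable (L : FirstOrder.Language.{u, u}) (U : Type u) [iS : L.Structure U]

section Helpers

/-- A relation on `U` is partial elementary if the pairs in it identify the elementary types of
its first and second coordinates. -/
def PartialElem (L : FirstOrder.Language.{u, u}) {U : Type u} [L.Structure U]
    (S : Set (U × U)) : Prop :=
  ∀ φ : L.Formula ↥S, φ.Realize (fun p => p.1.1) ↔ φ.Realize (fun p => p.1.2)

/-- Every family of `N`-definable sets, with `N` small, which has the finite intersection property
inside `X`, has a common point inside `X`. -/
def RelSat (L : FirstOrder.Language.{u, u}) {U : Type u} [L.Structure U] {n : ℕ}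
    (X : Set (Fin n → U)) : Prop :=
  ∀ N : Set U, #N < #U → ∀ F : Set (Set (Fin n → U)), (∀ D ∈ F, N.Definable L D) →
    (∀ G : Finset (Set (Fin n → U)), ↑G ⊆ F → ∃ c ∈ X, ∀ D ∈ G, c ∈ D) →
    ∃ c ∈ X, ∀ D ∈ F, c ∈ D

theorem IsSatStr.exists_mem_forall {U : Type u} {L' : FirstOrder.Language.{u, u}}
    {S : L'.Structure U} (hS : IsSatStr U S) {N : Set U} (hN : #N < #U) {m : ℕ}
    {F : Set (Set (Fin m → U))} (hF : ∀ D ∈ F, N.Definable L' D)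
    (hfin : ∀ G : Finset (Set (Fin m → U)), ↑G ⊆ F → ∃ c, ∀ D ∈ G, c ∈ D) :
    ∃ c, ∀ D ∈ F, c ∈ D := by
  classical
  obtain ⟨b, hb⟩ := hS N hN m {φ | {c | FRealize U (addConsts U S N) φ c} ∈ F} (by
    intro s hs
    obtain ⟨c, hc⟩ := hfin (s.image fun φ => {c | FRealize U (addConsts U S N) φ c}) (by
      intro D hD
      obtain ⟨φ, hφ, rfl⟩ := Finset.mem_image.1 (Finset.mem_coe.1 hD)
      exact hs hφ)
    exact ⟨c, fun φ hφ => hc _ (Finset.mem_image_of_mem _ hφ)⟩)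
  refine ⟨b, fun D hD => ?_⟩
  obtain ⟨φ, rfl⟩ := hF D hD
  exact hb φ hD

theorem definable_expStr_of_definable {U : Type u} {L : FirstOrder.Language.{u, u}}
    [L.Structure U] {n k : ℕ} (C : Set (Fin n → U)) {N : Set U} {D : Set (Fin k → U)}
    (hD : N.Definable L D) :
    @Set.Definable U N (expLang L n) (expStr L U C) _ D := by
  let _ := expStr L U C
  let ι : L →ᴸ expLang L n := LHom.sumInl
  have : ι.IsExpansionOn U := ⟨fun _ _ => rfl, fun _ _ => rfl⟩
  exact hD.map_expansion ι

theorem definable_expStr_self {U : Type u} {L : FirstOrder.Language.{u, u}}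
    [L.Structure U] {n : ℕ} (C : Set (Fin n → U)) (N : Set U) :
    @Set.Definable U N (expLang L n) (expStr L U C) _ C := by
  let _ := expStr L U C
  let r : (predLang n).Relations n := ⟨⟨rfl⟩⟩
  let R : (expLang L n).Relations n := Sum.inr r
  refine Set.Definable.mono (A := ∅) (Set.empty_definable_iff.2
    ⟨R.formula fun i => Term.var i, ?_⟩) (Set.empty_subset _)
  ext c
  rw [Set.mem_ofPred_eq, Formula.realize_rel]
  rfl

theorem SatSet.relSat {U : Type u} {L : FirstOrder.Language.{u, u}} [L.Structure U] {n : ℕ}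
    {C : Set (Fin n → U)} (hC : SatSet L U C) {X : Set (Fin n → U)}
    (hX : ∀ N : Set U, @Set.Definable U N (expLang L n) (expStr L U C) _ X) : RelSat L X := by
  classical
  intro N hN F hF hfin
  obtain ⟨c, hc⟩ := IsSatStr.exists_mem_forall hC hN (F := insert X F)
    (by
      rintro D (rfl | hD)
      · exact hX N
      · exact definable_expStr_of_definable C (hF D hD))
    (by
      intro G hG
      obtain ⟨c, hcX, hc⟩ := hfin (G.erase X) (by
        intro D hD
        obtain ⟨h1, h2⟩ := Finset.mem_erase.1 (Finset.mem_coe.1 hD)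
        exact (hG h2).resolve_left h1)
      refine ⟨c, fun D hD => ?_⟩
      by_cases h : D = X
      · exact h ▸ hcX
      · exact hc D (Finset.mem_erase.2 ⟨h, hD⟩))
  exact ⟨c, hc X (Set.mem_insert _ _), fun D hD => hc D (Set.mem_insert_of_mem _ hD)⟩

theorem PartialElem.realize_iff {U : Type u} {L : FirstOrder.Language.{u, u}} [L.Structure U]
    {S : Set (U × U)} (hS : PartialElem L S) {α : Type*} (φ : L.Formula α) {v w : α → U}
    (h : ∀ i, (v i, w i) ∈ S) : φ.Realize v ↔ φ.Realize w := by
  have := hS (φ.relabel fun i => (⟨(v i, w i), h i⟩ : S))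
  rw [Formula.realize_relabel, Formula.realize_relabel] at this
  exact this

theorem PartialElem.mono {U : Type u} {L : FirstOrder.Language.{u, u}} [L.Structure U]
    {S T : Set (U × U)} (hT : PartialElem L T) (h : S ⊆ T) : PartialElem L S :=
  fun φ => hT.realize_iff φ fun p => h p.2

theorem PartialElem.swap {U : Type u} {L : FirstOrder.Language.{u, u}} [L.Structure U]
    {S : Set (U × U)} (hS : PartialElem L S) : PartialElem L (Prod.swap ⁻¹' S) :=
  fun φ => (hS.realize_iff φ fun p => p.2).symm

theorem PartialElem.of_finset {U : Type u} {L : FirstOrder.Language.{u, u}} [L.Structure U]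
    {S : Set (U × U)} (h : ∀ F : Finset (U × U), ↑F ⊆ S → PartialElem L (F : Set (U × U))) :
    PartialElem L S := by
  classical
  intro φ
  set F : Finset (U × U) := φ.freeVarFinset.image Subtype.val with hF
  have key : ∀ v : ↥S → U, ∀ w : ↥(F : Set (U × U)) → U,
      (∀ p (hp : p ∈ F) (hs : p ∈ S), w ⟨p, hp⟩ = v ⟨p, hs⟩) →
      (Formula.Realize (φ.restrictFreeVar fun x : φ.freeVarFinset =>
        (⟨x.1.1, Finset.mem_image_of_mem _ x.2⟩ : ↥(F : Set (U × U)))) w ↔ φ.Realize v) := by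
    intro v w hw
    exact BoundedFormula.realize_restrictFreeVar v fun a => hw _ _ a.1.2
  rw [← key _ (fun p => p.1.1) fun _ _ _ => rfl, ← key _ (fun p => p.1.2) fun _ _ _ => rfl]
  exact h F (by simp [hF]) _

theorem PartialElem.iUnion {U : Type u} {L : FirstOrder.Language.{u, u}} [L.Structure U]
    {ι : Type*} [Nonempty ι] {f : ι → Set (U × U)} (hf : Directed (· ⊆ ·) f)
    (h : ∀ i, PartialElem L (f i)) : PartialElem L (⋃ i, f i) := by
  refine .of_finset fun F hF => ?_
  obtain ⟨i, hi⟩ := hf.exists_mem_subset_of_finset_subset_biUnion hF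
  exact (h i).mono hi

theorem PartialElem.union_range {U : Type u} {L : FirstOrder.Language.{u, u}} [L.Structure U]
    {S : Set (U × U)} {α : Type*} {c d : α → U}
    (h : ∀ φ : L.Formula (↥S ⊕ α), φ.Realize (Sum.elim (fun p => p.1.1) c) →
      φ.Realize (Sum.elim (fun p => p.1.2) d)) :
    PartialElem L (S ∪ Set.range fun j => (c j, d j)) := by
  have h' : ∀ φ : L.Formula (↥S ⊕ α), φ.Realize (Sum.elim (fun p => p.1.1) c) ↔
      φ.Realize (Sum.elim (fun p => p.1.2) d) := fun φ =>
    ⟨h φ, fun hφ => by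
      by_contra hn
      exact Formula.realize_not.1 (h φ.not (Formula.realize_not.2 hn)) hφ⟩
  have he : ∀ t : ↥(S ∪ Set.range fun j => (c j, d j)), ∃ e : ↥S ⊕ α,
      t.1.1 = Sum.elim (fun p : ↥S => p.1.1) c e ∧ t.1.2 = Sum.elim (fun p : ↥S => p.1.2) d e := by
    rintro ⟨t, ht | ⟨j, rfl⟩⟩
    · exact ⟨Sum.inl ⟨t, ht⟩, rfl, rfl⟩
    · exact ⟨Sum.inr j, rfl, rfl⟩
  choose e he1 he2 using he
  intro φ
  have := h' (φ.relabel e)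
  rw [Formula.realize_relabel, Formula.realize_relabel] at this
  convert this using 2 <;> funext t
  · exact he1 t
  · exact he2 t

theorem definable_realize_fst {U : Type u} {L : FirstOrder.Language.{u, u}} [L.Structure U]
    (S : Set (U × U)) {α : Type*} (φ : L.Formula (↥S ⊕ α)) :
    (Prod.fst '' S).Definable L {z : α → U | φ.Realize (Sum.elim (fun p => p.1.1) z)} := by
  refine Set.definable_iff_exists_formula_sum.2
    ⟨φ.relabel (Sum.map (fun p => ⟨p.1.1, p.1, p.2, rfl⟩) id), ?_⟩
  ext z
  simp only [Set.mem_ofPred_eq, Formula.realize_relabel, Sum.elim_comp_map]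
  rfl

theorem definable_realize_snd {U : Type u} {L : FirstOrder.Language.{u, u}} [L.Structure U]
    (S : Set (U × U)) {α : Type*} (φ : L.Formula (↥S ⊕ α)) :
    (Prod.snd '' S).Definable L {z : α → U | φ.Realize (Sum.elim (fun p => p.1.2) z)} := by
  refine Set.definable_iff_exists_formula_sum.2
    ⟨φ.relabel (Sum.map (fun p => ⟨p.1.2, p.1, p.2, rfl⟩) id), ?_⟩
  ext z
  simp only [Set.mem_ofPred_eq, Formula.realize_relabel, Sum.elim_comp_map]
  rfl

theorem PartialElem.exists_insert {U : Type u} {L : FirstOrder.Language.{u, u}} [iS : L.Structure U]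
    (hsat : IsSatStr U iS) {S : Set (U × U)} (hS : PartialElem L S) (hcard : #S < #U) (a : U) :
    ∃ b, PartialElem L (insert (a, b) S) := by
  classical
  obtain ⟨c, hc⟩ := hsat.exists_mem_forall (N := Prod.snd '' S) (mk_image_le.trans_lt hcard)
    (m := 1) (F := {D | ∃ φ : L.Formula (↥S ⊕ Fin 1),
      φ.Realize (Sum.elim (fun p => p.1.1) fun _ => a) ∧
      D = {z | φ.Realize (Sum.elim (fun p => p.1.2) z)}})
    (by
      rintro D ⟨φ, -, rfl⟩
      exact definable_realize_snd S φ)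
    (by
      intro G hG
      have key : ∃ φ : L.Formula (↥S ⊕ Fin 1),
          φ.Realize (Sum.elim (fun p => p.1.1) fun _ => a) ∧
          ∀ z, φ.Realize (Sum.elim (fun p => p.1.2) z) → ∀ D ∈ G, z ∈ D := by
        induction G using Finset.induction_on with
        | empty => exact ⟨⊤, by simp, by simp⟩
        | insert D G _ ih =>
          obtain ⟨φ, hφ, hφG⟩ := ih fun D hD => hG (by simp [Finset.mem_coe.1 hD])
          obtain ⟨ψ, hψ, rfl⟩ := hG (Finset.mem_coe.2 (Finset.mem_insert_self _ _))
          refine ⟨φ ⊓ ψ, Formula.realize_inf.2 ⟨hφ, hψ⟩, fun z hz D hD => ?_⟩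
          rw [Formula.realize_inf] at hz
          rcases Finset.mem_insert.1 hD with rfl | hD
          · exact hz.2
          · exact hφG z hz.1 D hD
      obtain ⟨φ, hφ, hφG⟩ := key
      obtain ⟨z, hz⟩ := Formula.realize_iExs.1
        ((hS (φ.iExs (Fin 1))).1 (Formula.realize_iExs.2 ⟨fun _ => a, hφ⟩))
      exact ⟨z, hφG z hz⟩)
  refine ⟨c 0, (PartialElem.union_range (c := fun _ : Fin 1 => a) (d := c)
    fun φ hφ => hc _ ⟨φ, hφ, rfl⟩).mono ?_⟩
  rintro p (rfl | hp)
  · exact Or.inr ⟨0, rfl⟩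
  · exact Or.inl hp

theorem exists_total_relation {X : Type u} [Infinite X] {P : Set (X × X) → Prop}
    (hdir : ∀ {ι : Type u} [Nonempty ι] {f : ι → Set (X × X)}, Directed (· ⊆ ·) f →
      (∀ i, P (f i)) → P (⋃ i, f i))
    (hext : ∀ S, P S → #S < #X → ∀ a, ∃ q : X × X, P (insert (a, q.1) (insert (q.2, a) S)))
    {S₀ : Set (X × X)} (h₀ : P S₀) (hcard : #S₀ < #X) :
    ∃ S, S₀ ⊆ S ∧ P S ∧ (∀ a, ∃ b, (a, b) ∈ S) ∧ ∀ b, ∃ a, (a, b) ∈ S := by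
  classical
  obtain ⟨_, _, ho⟩ := Cardinal.exists_ord_eq_type_lt X
  let next : (a : X) → ((b : X) → b < a → X × X) → X × X := fun a ih =>
    if h : ∃ q : X × X, P (insert (a, q.1) (insert (q.2, a)
      (S₀ ∪ ⋃ b : Set.Iio a, {(b.1, (ih b.1 b.2).1), ((ih b.1 b.2).2, b.1)}))) then h.choose
    else (a, a)
  let g : X → X × X := (wellFounded_lt (α := X)).fix next
  let T : X → Set (X × X) := fun a => S₀ ∪ ⋃ b : Set.Iio a, {(b.1, (g b).1), ((g b).2, b.1)}
  let E : X → Set (X × X) := fun a => insert (a, (g a).1) (insert ((g a).2, a) (T a))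
  have hg : ∀ a, (∃ q : X × X, P (insert (a, q.1) (insert (q.2, a) (T a)))) → P (E a) := by
    intro a h
    have : g a = h.choose := by
      rw [show g a = next a fun b _ => g b from WellFounded.fix_eq _ _ _]
      exact dif_pos h
    simp only [E, this]
    exact h.choose_spec
  have hTE : ∀ a, T a ⊆ E a := fun a p hp => Or.inr (Or.inr hp)
  have hET : ∀ a b, a < b → E a ⊆ T b := by
    rintro a b hab p (rfl | rfl | hp | hp)
    · exact Or.inr (Set.mem_iUnion.2 ⟨⟨a, hab⟩, Or.inl rfl⟩)
    · exact Or.inr (Set.mem_iUnion.2 ⟨⟨a, hab⟩, Or.inr rfl⟩)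
    · exact Or.inl hp
    · obtain ⟨c, hc⟩ := Set.mem_iUnion.1 hp
      exact Or.inr (Set.mem_iUnion.2 ⟨⟨c, c.2.trans hab⟩, hc⟩)
  have hE : Monotone E := by
    intro a b hab
    rcases hab.eq_or_lt with rfl | h
    · exact subset_rfl
    · exact (hET a b h).trans (hTE b)
  have hchain : ∀ s : Set X, (∀ a ∈ s, P (E a)) → P (S₀ ∪ ⋃ a : s, E a) := by
    intro s hs
    let f : Option s → Set (X × X) := fun o => o.elim S₀ fun a => E a
    have hf : (⋃ o, f o) = S₀ ∪ ⋃ a : s, E a := Set.iUnion_option f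
    rw [← hf]
    refine hdir ?_ (Option.forall.2 ⟨h₀, fun a => hs a a.2⟩)
    rintro (_ | a) o
    · refine ⟨o, ?_, subset_rfl⟩
      rcases o with _ | b
      · exact subset_rfl
      · exact fun p hp => hTE _ (Or.inl hp)
    · rcases o with _ | b
      · exact ⟨some a, subset_rfl, fun p hp => hTE _ (Or.inl hp)⟩
      · rcases le_total a b with h | h
        · exact ⟨some b, hE h, subset_rfl⟩
        · exact ⟨some a, subset_rfl, hE h⟩
  have hTeq : ∀ a, T a = S₀ ∪ ⋃ b : Set.Iio a, E b := by
    intro a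
    apply subset_antisymm
    · rintro p (hp | hp)
      · exact Or.inl hp
      · obtain ⟨b, hb⟩ := Set.mem_iUnion.1 hp
        refine Or.inr (Set.mem_iUnion.2 ⟨b, ?_⟩)
        rcases hb with rfl | rfl
        · exact Or.inl rfl
        · exact Or.inr (Or.inl rfl)
    · rintro p (hp | hp)
      · exact Or.inl hp
      · obtain ⟨b, hb⟩ := Set.mem_iUnion.1 hp
        exact hET b a b.2 hb
  have hX : ℵ₀ ≤ #X := aleph0_le_mk X
  have hTcard : ∀ a, #(T a) < #X := by
    intro a
    refine (mk_union_le _ _).trans_lt (add_lt_of_lt hX hcard ?_)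
    have hIio : #(Set.Iio a) < #X := Cardinal.mk_Iio_lt a ho
    have hsub : (⋃ b : Set.Iio a, ({(b.1, (g b).1), ((g b).2, b.1)} : Set (X × X))) ⊆
        Set.range (fun b : Set.Iio a => (b.1, (g b).1)) ∪
          Set.range (fun b : Set.Iio a => ((g b).2, b.1)) := by
      intro p hp
      obtain ⟨b, rfl | rfl⟩ := Set.mem_iUnion.1 hp
      · exact Or.inl ⟨b, rfl⟩
      · exact Or.inr ⟨b, rfl⟩
    exact (mk_le_mk_of_subset hsub).trans_lt ((mk_union_le _ _).trans_lt
      (add_lt_of_lt hX (mk_range_le.trans_lt hIio) (mk_range_le.trans_lt hIio)))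
  have hPE : ∀ a, P (E a) := by
    intro a
    induction a using WellFoundedLT.induction with
    | ind a ih => exact hg a (hext _ (hTeq a ▸ hchain _ ih) (hTcard a) a)
  refine ⟨S₀ ∪ ⋃ a : (Set.univ : Set X), E a, Set.subset_union_left,
    hchain _ fun a _ => hPE a, fun a => ⟨(g a).1, ?_⟩, fun a => ⟨(g a).2, ?_⟩⟩
  · exact Or.inr (Set.mem_iUnion.2 ⟨⟨a, trivial⟩, Or.inl rfl⟩)
  · exact Or.inr (Set.mem_iUnion.2 ⟨⟨a, trivial⟩, Or.inr (Or.inl rfl)⟩)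

theorem PartialElem.exists_insert_insert {U : Type u} {L : FirstOrder.Language.{u, u}}
    [iS : L.Structure U] [Infinite U] (hsat : IsSatStr U iS) {S : Set (U × U)}
    (hS : PartialElem L S) (hcard : #S < #U) (a : U) :
    ∃ q : U × U, PartialElem L (insert (a, q.1) (insert (q.2, a) S)) := by
  have hpre : ∀ (p : U × U) (T : Set (U × U)),
      Prod.swap ⁻¹' insert p T = insert p.swap (Prod.swap ⁻¹' T) := by
    intro p T
    ext q
    simp only [Set.mem_preimage, Set.mem_insert_iff, Prod.swap_eq_iff_eq_swap]
  have hsw : #(Prod.swap ⁻¹' S : Set (U × U)) < #U := by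
    rwa [← Set.image_swap_eq_preimage_swap, mk_image_eq Prod.swap_injective]
  obtain ⟨x, hx⟩ := hS.swap.exists_insert hsat hsw a
  have hx' := hx.swap
  rw [hpre, ← Set.preimage_comp, Prod.swap_swap_eq, Set.preimage_id] at hx'
  obtain ⟨y, hy⟩ := hx'.exists_insert hsat
    (mk_insert_le.trans_lt (add_lt_of_lt (aleph0_le_mk U) hcard
      (one_lt_aleph0.trans_le (aleph0_le_mk U)))) a
  exact ⟨(y, x), hy⟩

theorem PartialElem.exists_equiv {U : Type u} {L : FirstOrder.Language.{u, u}}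
    [iS : L.Structure U] [Infinite U] (hsat : IsSatStr U iS) {S : Set (U × U)}
    (hS : PartialElem L S) (hcard : #S < #U) :
    ∃ f : U ≃[L] U, ∀ p ∈ S, f p.1 = p.2 := by
  obtain ⟨T, hST, hT, hdom, hran⟩ := exists_total_relation (P := PartialElem L)
    PartialElem.iUnion (fun S hS hc a => hS.exists_insert_insert hsat hc a) hS hcard
  choose f hf using hdom
  choose g hg using hran
  have heq : ∀ {a b c d : U}, (a, b) ∈ T → (c, d) ∈ T → (a = c ↔ b = d) := by
    intro a b c d h1 h2
    have := hT.realize_iff (Term.equal (Term.var (0 : Fin 2)) (Term.var (1 : Fin 2)))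
      (v := ![a, c]) (w := ![b, d]) (by simp [Fin.forall_fin_two, h1, h2])
    simpa using this
  let e : U ≃ U :=
    { toFun := f
      invFun := g
      left_inv := fun a => (heq (hg (f a)) (hf a)).2 rfl
      right_inv := fun b => (heq (hf (g b)) (hg b)).1 rfl }
  refine ⟨{ e with
    map_fun' := ?_
    map_rel' := ?_ }, fun p hp => (heq (hf p.1) (hST hp)).1 rfl⟩
  · intro k F x
    have := hT.realize_iff (Formula.graph F) (v := Fin.cons (Structure.funMap F x) x)
      (w := Fin.cons (f (Structure.funMap F x)) (f ∘ x))
      (fun i => Fin.cases (hf _) (fun j => hf _) i)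
    rw [Formula.realize_graph, Formula.realize_graph] at this
    exact (this.1 rfl).symm
  · intro k R x
    have := hT.realize_iff (R.formula fun i : Fin k => Term.var i) (v := x) (w := f ∘ x)
      (fun i => hf _)
    rw [Formula.realize_rel, Formula.realize_rel] at this
    exact this.symm

theorem PartialElem.union_range_of_ultrafilter {U : Type u} {L : FirstOrder.Language.{u, u}}
    [L.Structure U] {S : Set (U × U)} (hS : PartialElem L S) {n : ℕ} {B : Set (Fin n → U)}
    (hBS : ∀ b ∈ B, ∀ i, (b i, b i) ∈ S) {W : Ultrafilter (Fin n → U)} (hB : B ∈ W)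
    {c d : Fin n → U} (hc : ∀ D ∈ W, (Prod.fst '' S).Definable L D → c ∈ D)
    (hd : ∀ D ∈ W, (Prod.snd '' S).Definable L D → d ∈ D) :
    PartialElem L (S ∪ Set.range fun j => (c j, d j)) := by
  refine .union_range fun φ hφ => ?_
  set D : Set (Fin n → U) := {z | φ.Realize (Sum.elim (fun p => p.1.1) z)}
  set E : Set (Fin n → U) := {z | φ.Realize (Sum.elim (fun p => p.1.2) z)}
  have hD : D ∈ W := by
    by_contra h
    exact hc Dᶜ (Ultrafilter.compl_mem_iff_notMem.2 h) (definable_realize_fst S φ).compl hφ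
  have hE : E ∈ W := by
    filter_upwards [hD, hB] with b hbD hbB
    exact (hS.realize_iff φ (by rintro (p | j); exacts [p.2, hBS b hbB j])).1 hbD
  exact hd E hE (definable_realize_snd S φ)

theorem exists_ultrafilter_of_not_between {X : Type*} {B C : Set X} {𝒟 : Set (Set X)}
    (hempty : ∅ ∈ 𝒟) (hunion : ∀ D ∈ 𝒟, ∀ E ∈ 𝒟, D ∪ E ∈ 𝒟)
    (hBC : ∀ D ∈ 𝒟, B ⊆ D → ¬D ⊆ C) :
    ∃ W : Ultrafilter X, B ∈ W ∧ ∀ D ∈ 𝒟, D ∈ W → ¬D ⊆ C := by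
  let F : Filter X :=
    { sets := {s | ∃ D ∈ 𝒟, D ⊆ C ∧ B ⊆ s ∪ D}
      univ_sets := ⟨∅, hempty, Set.empty_subset _, by simp⟩
      sets_of_superset := by
        rintro s t ⟨D, hD, hDC, hs⟩ hst
        exact ⟨D, hD, hDC, hs.trans (Set.union_subset_union_left _ hst)⟩
      inter_sets := by
        rintro s t ⟨D, hD, hDC, hs⟩ ⟨E, hE, hEC, ht⟩
        refine ⟨D ∪ E, hunion D hD E hE, Set.union_subset hDC hEC, fun b hb => ?_⟩
        rcases hs hb with h1 | h1
        · rcases ht hb with h2 | h2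
          · exact Or.inl ⟨h1, h2⟩
          · exact Or.inr (Or.inr h2)
        · exact Or.inr (Or.inl h1) }
  have hF : F.NeBot := by
    refine Filter.neBot_iff.2 fun h => ?_
    obtain ⟨D, hD, hDC, hBD⟩ : ∅ ∈ F := h ▸ Filter.mem_bot
    exact hBC D hD (by simpa using hBD) hDC
  refine ⟨Ultrafilter.of F, Ultrafilter.of_le F ⟨∅, hempty, Set.empty_subset _, by simp⟩,
    fun D hD hDW hDC => ?_⟩
  exact Ultrafilter.compl_notMem_iff.2 hDW
    (Ultrafilter.of_le F ⟨D, hD, hDC, fun b _ => (em (b ∈ D)).symm⟩)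

theorem definable_singleton_tuple_s8 {U : Type u} {L : FirstOrder.Language.{u, u}} [L.Structure U]
    {n : ℕ} {N : Set U} {x : Fin n → U} (hx : ∀ i, x i ∈ N) : N.Definable L {x} := by
  have h : N.Definable L (⋂ i ∈ (Finset.univ : Finset (Fin n)), {z : Fin n → U | z i = x i}) :=
    Set.definable_biInter_finset
      (fun i => Set.DefinableFun.ofPred_eq_const (Set.DefinableFun.proj L) (hx i)) _
  convert h using 1
  ext z
  simp [funext_iff]

theorem exists_finset_partialElem {U : Type u} {L : FirstOrder.Language.{u, u}}
    [L.Structure U] (hreg : Cardinal.IsRegular #U) {n : ℕ} {B C : Set (Fin n → U)} {N : Set U} (hN : #N < #U)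
    (hBN : ∀ b ∈ B, ∀ i, b i ∈ N) (hBC : B ⊆ C)
    (hno : ∀ D : Set (Fin n → U), Set.univ.Definable L D → B ⊆ D → ¬D ⊆ C)
    (hC : RelSat L C) (hC' : RelSat L Cᶜ) (K : ℕ) :
    ∃ s : Finset (Fin n → U), s.card = K ∧ ∀ H : Set (Fin n → U), ∃ S : Set (U × U),
      PartialElem L S ∧ #S < #U ∧ (∀ a ∈ N, (a, a) ∈ S) ∧
      ∀ x ∈ s, ∃ y, (y ∈ C ↔ x ∈ H) ∧ ∀ j, (x j, y j) ∈ S := by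
  classical
  have hU : ℵ₀ ≤ #U := hreg.aleph0_le
  obtain ⟨W, hBW, hW⟩ := exists_ultrafilter_of_not_between
    (𝒟 := {D | Set.univ.Definable L D}) Set.definable_empty (fun D hD E hE => hD.union hE) hno
  have hreal : ∀ (q : Prop) (M : Set U), #M < #U →
      ∃ c, (c ∈ C ↔ q) ∧ ∀ D ∈ W, M.Definable L D → c ∈ D := by
    intro q M hM
    have hfin : ∀ G : Finset (Set (Fin n → U)), ↑G ⊆ {D | D ∈ W ∧ M.Definable L D} →
        (⋂₀ (G : Set (Set (Fin n → U)))) ∈ W ∧ M.Definable L (⋂ D ∈ G, D) := by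
      intro G hG
      refine ⟨(Filter.sInter_mem G.finite_toSet).2 fun D hD => (hG hD).1, ?_⟩
      induction G using Finset.induction_on with
      | empty => simp
      | insert D G _ ih =>
        rw [Finset.set_biInter_insert]
        exact (hG (by simp)).2.inter (ih fun E hE => hG (by simp [Finset.mem_coe.1 hE]))
    by_cases hq : q
    · obtain ⟨c, hcC, hc⟩ := hC M hM {D | D ∈ W ∧ M.Definable L D} (fun D hD => hD.2) (by
        intro G hG
        obtain ⟨b, hb, hbB⟩ := W.nonempty_of_mem (Filter.inter_mem (hfin G hG).1 hBW)
        exact ⟨b, hBC hbB, fun D hD => hb D hD⟩)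
      exact ⟨c, by simp [hq, hcC], fun D hD hDM => hc D ⟨hD, hDM⟩⟩
    · obtain ⟨c, hcC, hc⟩ := hC' M hM {D | D ∈ W ∧ M.Definable L D} (fun D hD => hD.2) (by
        intro G hG
        obtain ⟨h1, h2⟩ := hfin G hG
        rw [Set.sInter_eq_biInter] at h1
        obtain ⟨b, hb, hbC⟩ := Set.not_subset.1 (hW _ (h2.mono (Set.subset_univ _)) h1)
        exact ⟨b, hbC, fun D hD => Set.mem_iInter₂.1 hb D hD⟩)
      exact ⟨c, by simpa [hq] using hcC, fun D hD hDM => hc D ⟨hD, hDM⟩⟩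
  induction K with
  | zero =>
    refine ⟨∅, rfl, fun H => ⟨(fun a => (a, a)) '' N, ?_, mk_image_le.trans_lt hN,
      fun a ha => ⟨a, ha, rfl⟩, by simp⟩⟩
    intro φ
    have : (fun p : ↥((fun a : U => (a, a)) '' N) => p.1.1) = fun p => p.1.2 := by
      funext ⟨p, a, _, hp⟩
      exact congrArg Prod.fst hp.symm |>.trans (congrArg Prod.snd hp)
    rw [this]
  | succ K ih =>
    obtain ⟨s, hs, hsH⟩ := ih
    choose S hS hScard hSN hSx using hsH
    let M : Set U := ⋃ t : s.powerset, Prod.fst '' S (t.1 : Set (Fin n → U))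
    have hM : #M < #U := (card_iUnion_lt_iff_forall_of_isRegular hreg
      ((lt_aleph0_of_finite _).trans_le hU)).2 fun t => mk_image_le.trans_lt (hScard _)
    obtain ⟨c, -, hc⟩ := hreal True M hM
    have hcs : c ∉ s := by
      intro hcs
      have hcM : ∀ i, c i ∈ M := by
        intro i
        obtain ⟨y, -, hy⟩ := hSx ∅ c hcs
        exact Set.mem_iUnion.2 ⟨⟨∅, by simp⟩, (c i, y i), by simpa using hy i, rfl⟩
      have hdef := definable_singleton_tuple_s8 (L := L) hcM
      by_cases hcW : {c} ∈ W
      · obtain ⟨b, hb, hbB⟩ := W.nonempty_of_mem (Filter.inter_mem hcW hBW)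
        rw [Set.mem_singleton_iff] at hb
        exact hW _ (hdef.mono (Set.subset_univ _)) hcW
          (Set.singleton_subset_iff.2 (hBC (hb ▸ hbB)))
      · exact hc _ (Ultrafilter.compl_mem_iff_notMem.2 hcW) hdef.compl rfl
    refine ⟨insert c s, by rw [Finset.card_insert_of_notMem hcs, hs], fun H => ?_⟩
    let t : Finset (Fin n → U) := s.filter (· ∈ H)
    have ht : t ∈ s.powerset := Finset.mem_powerset.2 (Finset.filter_subset _ _)
    obtain ⟨d, hdC, hd⟩ := hreal (c ∈ H) (Prod.snd '' S t) (mk_image_le.trans_lt (hScard t))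
    refine ⟨S t ∪ Set.range fun j => (c j, d j), (hS t).union_range_of_ultrafilter
      (fun b hb i => hSN t _ (hBN b hb i)) hBW (fun D hD hDS => hc D hD (hDS.mono ?_)) hd,
      ?_, fun a ha => Or.inl (hSN t a ha), ?_⟩
    · exact Set.subset_iUnion (fun t : s.powerset => Prod.fst '' S (t.1 : Set (Fin n → U))) ⟨t, ht⟩
    · exact (mk_union_le _ _).trans_lt (add_lt_of_lt hU (hScard t)
        ((Set.finite_range _).lt_aleph0.trans_le hU))
    · intro x hx
      rcases Finset.mem_insert.1 hx with rfl | hx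
      · exact ⟨d, hdC, fun j => Or.inr ⟨j, rfl⟩⟩
      · obtain ⟨y, hyC, hy⟩ := hSx t x hx
        exact ⟨y, by simpa [t, hx] using hyC, fun j => Or.inl (hy j)⟩

theorem mk_sigma_formula_lt {L : FirstOrder.Language.{u, u}} {κ : Cardinal.{u}} (hκ : ℵ₀ < κ)
    (hreg : Cardinal.IsRegular κ) (hcard : L.card < κ) (n : ℕ) :
    #(Σ m : ℕ, L.Formula (Fin m ⊕ Fin n)) < κ := by
  rw [mk_sigma]
  refine sum_lt_lift_of_isRegular hreg (by simpa using hκ) fun m => ?_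
  have hinj : Function.Injective (fun φ : L.Formula (Fin m ⊕ Fin n) =>
      (⟨0, φ⟩ : Σ k, L.BoundedFormula (Fin m ⊕ Fin n) k)) :=
    fun _ _ h => eq_of_heq (Sigma.mk.inj h).2
  refine (mk_le_of_injective hinj).trans_lt (BoundedFormula.card_le.trans_lt (max_lt hκ ?_))
  refine add_lt_of_lt hκ.le ?_ (by simpa using hcard)
  exact (lift_lt_aleph0.2 (lt_aleph0_of_finite _)).trans hκ

theorem approxBelow_of_relSat {U : Type u} {L : FirstOrder.Language.{u, u}}
    [iS : L.Structure U] (hsat : IsSatStr U iS) (hU : ℵ₀ < #U) (hreg : Cardinal.IsRegular #U) (hcard : L.card < #U)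
    {n : ℕ} {C : Set (Fin n → U)} {A : Set U} (hA : #A < #U)
    (hC : RelSat L C) (hC' : RelSat L Cᶜ) {K : ℕ}
    (hvc : ∀ s : Finset (Fin n → U), s.card = K → ∃ H : Set (Fin n → U),
      ∀ f ∈ AutFix L U A, ∃ x ∈ s, ¬(⇑f ∘ x ∈ C ↔ x ∈ H)) :
    ApproxBelow L U C := by
  have : Infinite U := infinite_iff.2 hU.le
  by_contra hno
  have hbad : ∀ q : Σ m : ℕ, L.Formula (Fin m ⊕ Fin n), ∃ B : Finset U, ∀ b : Fin q.1 → U,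
      phiSet L U q.2 b ∩ tuplesIn U ↑B = C ∩ tuplesIn U ↑B → ¬phiSet L U q.2 b ⊆ C := by
    intro q
    by_contra h
    push Not at h
    exact hno ⟨q.1, q.2, h⟩
  choose B hB using hbad
  let N : Set U := A ∪ ⋃ q, (B q : Set U)
  have hN : #N < #U := by
    refine (mk_union_le _ _).trans_lt (add_lt_of_lt hU.le hA ?_)
    exact (card_iUnion_lt_iff_forall_of_isRegular hreg (mk_sigma_formula_lt hU hreg hcard n)).2
      fun q => (lt_aleph0_of_finite _).trans hU
  have hsub : ∀ D : Set (Fin n → U), Set.univ.Definable L D →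
      C ∩ tuplesIn U N ⊆ D → ¬D ⊆ C := by
    intro D hD hCD hDC
    obtain ⟨A₀, -, hD⟩ := Set.definable_iff_finitely_definable.1 hD
    obtain ⟨φ, rfl⟩ := Set.definable_iff_exists_formula_sum.1 hD
    let e := A₀.equivFin
    let ψ : L.Formula (Fin A₀.card ⊕ Fin n) := φ.relabel (Sum.map e id)
    have hψ : phiSet L U ψ (fun i => (e.symm i : U)) = {v | φ.Realize (Sum.elim (↑) v)} := by
      ext z
      simp only [phiSet, ψ, Set.mem_ofPred_eq, Formula.realize_relabel, Sum.elim_comp_map]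
      simp only [Function.comp_def, e.symm_apply_apply, id_eq]
      rfl
    refine hB ⟨_, ψ⟩ (fun i => (e.symm i : U)) ?_ (hψ ▸ hDC)
    rw [hψ]
    refine subset_antisymm (Set.inter_subset_inter_left _ hDC) fun z hz => ⟨hCD ⟨hz.1, ?_⟩, hz.2⟩
    exact fun i => Or.inr (Set.mem_iUnion.2 ⟨⟨_, ψ⟩, hz.2 i⟩)
  obtain ⟨s, hs, hsH⟩ := exists_finset_partialElem hreg hN (fun b hb => hb.2) Set.inter_subset_left
    hsub hC hC' K
  obtain ⟨H, hH⟩ := hvc s hs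
  obtain ⟨S, hS, hScard, hSN, hSx⟩ := hsH H
  obtain ⟨f, hf⟩ := hS.exists_equiv hsat hScard
  obtain ⟨x, hx, hne⟩ := hH f fun a ha => hf _ (hSN a (Or.inl ha))
  obtain ⟨y, hyC, hy⟩ := hSx x hx
  have : ⇑f ∘ x = y := funext fun j => hf _ (hy j)
  exact hne (this ▸ hyC)

theorem FiniteVC.exists_forall_autFix {U : Type u} {L : FirstOrder.Language.{u, u}}
    [L.Structure U] {n : ℕ} {C : Set (Fin n → U)} {A : Set U} (h : FiniteVC (oSet L U A C)) :
    ∃ K : ℕ, ∀ s : Finset (Fin n → U), s.card = K → ∃ H : Set (Fin n → U),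
      ∀ f ∈ AutFix L U A, ∃ x ∈ s, ¬(⇑f ∘ x ∈ C ↔ x ∈ H) := by
  obtain ⟨K, hK⟩ := h
  refine ⟨K, fun s hs => ?_⟩
  by_contra hno
  push Not at hno
  refine hK s hs fun H hH => ?_
  obtain ⟨f, hf, hfH⟩ := hno H
  refine ⟨imgSet L U f.symm C, ⟨f.symm, fun a ha => ?_, rfl⟩, ?_⟩
  · exact (congrArg f.symm (hf a ha)).symm.trans (f.symm_apply_apply a)
  · have hmem : ∀ x, x ∈ imgSet L U f.symm C ↔ ⇑f ∘ x ∈ C := by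
      intro x
      constructor
      · rintro ⟨y, hy, rfl⟩
        simpa [Function.comp_def] using hy
      · exact fun hx => ⟨_, hx, by simp [Function.comp_def]⟩
    ext x
    constructor
    · rintro ⟨hx, hxs⟩
      exact (hfH x hxs).1 ((hmem x).1 hx)
    · exact fun hx => ⟨(hmem x).2 ((hfH x (hH hx)).2 hx), hH hx⟩

theorem ApproxBelow.compl {U : Type u} {L : FirstOrder.Language.{u, u}}
    [L.Structure U] {n : ℕ} {C : Set (Fin n → U)} (h : ApproxBelow L U Cᶜ) :
    ApproxAbove L U C := by
  obtain ⟨m, φ, hφ⟩ := h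
  refine ⟨m, φ.not, fun B => ?_⟩
  obtain ⟨b, hb, hbC⟩ := hφ B
  have hnot : phiSet L U φ.not b = (phiSet L U φ b)ᶜ := by
    ext z
    exact Formula.realize_not
  refine ⟨b, ?_, ?_⟩
  · rw [hnot]
    ext z
    have := Set.ext_iff.1 hb z
    simp only [Set.mem_inter_iff, Set.mem_compl_iff] at this ⊢
    tauto
  · rw [hnot]
    exact Set.subset_compl_comm.1 hbC

end Helpers

/-- a saturated `C` whose orbit `o(C/A)` has finite VC dimension is
approximable from below and from above. -/
theorem stmt8 (L : FirstOrder.Language.{u, u}) (U : Type u) [iS : L.Structure U]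
    (hsat : IsSatStr U iS) (hinacc : Cardinal.IsInaccessible #U) (hcard : L.card < #U)
    (n : ℕ) (C : Set (Fin n → U)) (A : Set U) (hA : #A < #U)
    (hCsat : SatSet L U C) (hvc : FiniteVC (oSet L U A C)) :
    ApproxBelow L U C ∧ ApproxAbove L U C := by
  have hC := hCsat.relSat fun N => definable_expStr_self C N
  have hC' := hCsat.relSat (X := Cᶜ) fun N => by
    let _ := expStr L U C
    exact (definable_expStr_self C N).compl
  obtain ⟨K, hK⟩ := hvc.exists_forall_autFix
  refine ⟨approxBelow_of_relSat hsat hinacc.aleph0_lt hinacc.isRegular hcard hA hC hC' hK, ApproxBelow.compl ?_⟩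
  refine approxBelow_of_relSat (K := K) hsat hinacc.aleph0_lt hinacc.isRegular hcard hA hC'
    ((compl_compl C).symm ▸ hC) fun s hs => ?_
  obtain ⟨H, hH⟩ := hK s hs
  refine ⟨Hᶜ, fun f hf => ?_⟩
  obtain ⟨x, hx, hne⟩ := hH f hf
  exact ⟨x, hx, fun h => hne (not_iff_not.1 h)⟩

end Paper
end

section
/- Assume e(D/A) has finite VC-dimension for some small set A ⊆ U. Then D is approximable from below and approximable from above (in particular, D is externally definable). -/
namespace Paper

open FirstOrder Language Cardinal Set

universe u

variable (L : FirstOrder.Language.{u, u}) (U : Type u) [iS : L.Structure U]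

section Approximation

variable {L U}

/-- Every `∅`-definable set depends on finitely many coordinates only. -/
theorem definable_finite_support {P : Type*} {R : Set (P → U)}
    (hR : (∅ : Set U).Definable L R) :
    ∃ (T : Finset P) (S : Set (T → U)), (∅ : Set U).Definable L S ∧
      ∀ v : P → U, v ∈ R ↔ (fun t : T => v t) ∈ S := by
  classical
  obtain ⟨φ, rfl⟩ := empty_definable_iff.1 hR
  refine ⟨BoundedFormula.freeVarFinset φ, _,
    empty_definable_iff.2 ⟨BoundedFormula.restrictFreeVar φ id, rfl⟩, fun v => ?_⟩
  exact (BoundedFormula.realize_restrictFreeVar (φ := φ) (f := id) (xs := default) v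
    fun a => rfl).symm

/-- Projecting a `∅`-definable set of assignments of all elements of `U` to the coordinates in
`W` and to the finitely many coordinates listed by `c`. -/
theorem definable_restrict {K : Type*} [Finite K] (W : Set U) (c : K → U)
    {E : Set (U → U)} (hE : (∅ : Set U).Definable L E) (hid : id ∈ E) :
    ∃ θ : Set (↥W ⊕ K → U), (∅ : Set U).Definable L θ ∧ Sum.elim Subtype.val c ∈ θ ∧
      ∀ σ ∈ θ, ∃ v ∈ E, (∀ w : W, v w = σ (Sum.inl w)) ∧ ∀ k, v (c k) = σ (Sum.inr k) := by
  classical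
  obtain ⟨T, S, hS, hTS⟩ := definable_finite_support hE
  let B : Set U := ↑T ∪ range c
  have hB : B.Finite := T.finite_toSet.union (finite_range c)
  have : Finite B := hB
  let α := {w : W // (w : U) ∈ B} ⊕ K
  have : Finite {w : W // (w : U) ∈ B} :=
    Finite.of_injective (fun w => (⟨w.1, w.2⟩ : B)) fun w w' h => by
      simpa [Subtype.ext_iff] using h
  let f : α → B := Sum.elim (fun w => ⟨w.1, w.2⟩) fun k => ⟨c k, Or.inr ⟨k, rfl⟩⟩
  let j : T → B := fun t => ⟨t, Or.inl t.2⟩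
  refine ⟨_, ((hS.preimage_comp j).image_comp f).preimage_comp
    (Sum.map Subtype.val id : α → ↥W ⊕ K), ?_, ?_⟩
  · refine ⟨Subtype.val, (hTS id).1 hid, ?_⟩
    ext (w | k) <;> rfl
  · rintro σ ⟨g, hg, hgσ⟩
    refine ⟨fun t => if h : t ∈ B then g ⟨t, h⟩ else if h' : t ∈ W then σ (Sum.inl ⟨t, h'⟩) else t,
      (hTS _).2 ?_, fun w => ?_, fun k => ?_⟩
    · have : (fun t : T => if h : (t : U) ∈ B then g ⟨t, h⟩ else
          if h' : (t : U) ∈ W then σ (Sum.inl ⟨t, h'⟩) else t) = g ∘ j :=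
        funext fun t => dif_pos (j t).2
      rw [this]
      exact hg
    · by_cases h : (w : U) ∈ B
      · exact (dif_pos h).trans (congrFun hgσ (Sum.inl ⟨w, h⟩))
      · simp [h]
    · have h : c k ∈ B := Or.inr ⟨k, rfl⟩
      exact (dif_pos h).trans (congrFun hgσ (Sum.inr k))

theorem frealize_addConsts_iff {W : Set U} {α : Type*} (φ : (L[[↥W]]).Formula α) (b : α → U) :
    FRealize U (addConsts U iS W) φ b ↔
      Formula.Realize (M := U) (BoundedFormula.constantsVarsEquiv φ : L.Formula (↥W ⊕ α))
        (Sum.elim Subtype.val b) := by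
  let _ : (constantsOn ↥W).Structure U := constantsOn.structure Subtype.val
  exact (BoundedFormula.realize_constantsVarsEquiv (M := U) (φ := φ) (v := b)).symm

/-- Saturation of `U`, phrased for families of `∅`-definable sets. -/
theorem IsSatStr.exists_mem_of_definable (hsat : IsSatStr U iS) {W : Set U} (hW : #W < #U)
    {K : Type*} [Finite K] (𝒮 : Set (Set (↥W ⊕ K → U)))
    (hdef : ∀ R ∈ 𝒮, (∅ : Set U).Definable L R) (huniv : Set.univ ∈ 𝒮)
    (hinter : ∀ R ∈ 𝒮, ∀ R' ∈ 𝒮, R ∩ R' ∈ 𝒮)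
    (hne : ∀ R ∈ 𝒮, ∃ b : K → U, Sum.elim Subtype.val b ∈ R) :
    ∃ b : K → U, ∀ R ∈ 𝒮, Sum.elim Subtype.val b ∈ R := by
  classical
  obtain ⟨m, ⟨e⟩⟩ := Finite.exists_equiv_fin K
  let F : (L[[↥W]]).Formula (Fin m) → Set (↥W ⊕ K → U) := fun φ =>
    {σ | Formula.Realize (M := U) (BoundedFormula.constantsVarsEquiv φ : L.Formula (↥W ⊕ Fin m))
      (σ ∘ Sum.map id e.symm)}
  have hF : ∀ φ (b : Fin m → U), FRealize U (addConsts U iS W) φ b ↔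
      Sum.elim Subtype.val (b ∘ e) ∈ F φ := by
    intro φ b
    rw [frealize_addConsts_iff]
    have : (Sum.elim Subtype.val (b ∘ e) : ↥W ⊕ K → U) ∘ Sum.map id e.symm =
        Sum.elim Subtype.val b := by
      ext (w | i) <;> simp
    simp only [F, mem_ofPred_eq, this]
  obtain ⟨b, hb⟩ := hsat W hW m {φ | F φ ∈ 𝒮} fun s hs => by
    have key : (⋂ φ ∈ s, F φ) ∈ 𝒮 := by
      induction s using Finset.induction_on with
      | empty => simpa using huniv
      | insert φ s _ ih =>
        rw [Finset.set_biInter_insert]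
        exact hinter _ (hs (by simp)) _ (ih fun ψ hψ => hs (by simp [Finset.mem_coe.1 hψ]))
    obtain ⟨b, hb⟩ := hne _ key
    refine ⟨b ∘ e.symm, fun φ hφ => (hF φ _).2 ?_⟩
    have := mem_iInter₂.1 hb φ hφ
    simpa [Function.comp_assoc] using this
  refine ⟨b ∘ e, fun R hR => ?_⟩
  obtain ⟨φ, rfl⟩ := empty_definable_iff.1 (hdef R hR)
  let ψ : (L[[↥W]]).Formula (Fin m) :=
    BoundedFormula.constantsVarsEquiv.symm (φ.relabel (Sum.map id e : ↥W ⊕ K → ↥W ⊕ Fin m))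
  have hψ : F ψ = Set.ofPred φ.Realize := by
    ext σ
    have : (σ ∘ Sum.map id e.symm) ∘ Sum.map id e = σ := by
      ext (w | i) <;> simp
    simp [F, ψ, Formula.realize_relabel, this]
  rw [← hψ]
  exact (hF ψ b).1 (hb ψ (by rw [mem_ofPred_eq, hψ]; exact hR))

variable (L) in
/-- `Y` is uniformly covered by instances of a single `∅`-definable relation contained in `D`. -/
def IsCoverable {n : ℕ} (D Y : Set (Fin n → U)) : Prop :=
  ∃ (P : Type u) (R : Set (P ⊕ Fin n → U)), (∅ : Set U).Definable L R ∧
    ∀ B : Finset (Fin n → U), ↑B ⊆ Y → ∃ b : P → U,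
      (∀ d ∈ B, Sum.elim b d ∈ R) ∧ ∀ d, Sum.elim b d ∈ R → d ∈ D

theorem isCoverable_empty {n : ℕ} (D : Set (Fin n → U)) : IsCoverable L D ∅ :=
  ⟨PEmpty, ∅, definable_empty, fun _ hB =>
    ⟨PEmpty.elim, fun _ hd => (hB hd).elim, fun _ hd => hd.elim⟩⟩

theorem IsCoverable.mono {n : ℕ} {D Y Y' : Set (Fin n → U)} (h : IsCoverable L D Y)
    (hY : Y' ⊆ Y) : IsCoverable L D Y' := by
  obtain ⟨P, R, hR, h⟩ := h
  exact ⟨P, R, hR, fun B hB => h B (hB.trans hY)⟩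

theorem IsCoverable.union {n : ℕ} {D Y₁ Y₂ : Set (Fin n → U)} (h₁ : IsCoverable L D Y₁)
    (h₂ : IsCoverable L D Y₂) : IsCoverable L D (Y₁ ∪ Y₂) := by
  classical
  obtain ⟨P₁, R₁, hR₁, h₁⟩ := h₁
  obtain ⟨P₂, R₂, hR₂, h₂⟩ := h₂
  let f₁ : P₁ ⊕ Fin n → (P₁ ⊕ P₂) ⊕ Fin n := Sum.map Sum.inl id
  let f₂ : P₂ ⊕ Fin n → (P₁ ⊕ P₂) ⊕ Fin n := Sum.map Sum.inr id
  refine ⟨P₁ ⊕ P₂, _, (hR₁.preimage_comp f₁).union (hR₂.preimage_comp f₂), fun B hB => ?_⟩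
  obtain ⟨b₁, hb₁, hb₁'⟩ := h₁ (B.filter (· ∈ Y₁)) fun d hd => (Finset.mem_filter.1 hd).2
  obtain ⟨b₂, hb₂, hb₂'⟩ := h₂ (B.filter (· ∈ Y₂)) fun d hd => (Finset.mem_filter.1 hd).2
  have e₁ : ∀ d : Fin n → U, Sum.elim (Sum.elim b₁ b₂) d ∘ f₁ = Sum.elim b₁ d := fun d => by
    ext (x | x) <;> rfl
  have e₂ : ∀ d : Fin n → U, Sum.elim (Sum.elim b₁ b₂) d ∘ f₂ = Sum.elim b₂ d := fun d => by
    ext (x | x) <;> rfl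
  refine ⟨Sum.elim b₁ b₂, fun d hd => ?_, fun d hd => ?_⟩
  · refine (hB hd).imp (fun h => ?_) fun h => ?_
    · exact mem_preimage.2 ((e₁ d).symm ▸ hb₁ d (Finset.mem_filter.2 ⟨hd, h⟩))
    · exact mem_preimage.2 ((e₂ d).symm ▸ hb₂ d (Finset.mem_filter.2 ⟨hd, h⟩))
  · rcases hd with hd | hd
    · rw [mem_preimage, e₁] at hd
      exact hb₁' d hd
    · rw [mem_preimage, e₂] at hd
      exact hb₂' d hd

/-- If `D` is not coverable, some ultrafilter containing `D` avoids all coverable subsets. -/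
theorem exists_ultrafilter_of_not_isCoverable {n : ℕ} {D : Set (Fin n → U)}
    (hD : ¬IsCoverable L D D) :
    ∃ 𝓕 : Ultrafilter (Fin n → U), D ∈ 𝓕 ∧ ∀ Y ∈ 𝓕, Y ⊆ D → ¬IsCoverable L D Y := by
  let F : Filter (Fin n → U) :=
    { sets := {Y | IsCoverable L D (D \ Y)}
      univ_sets := by
        change IsCoverable L D (D \ Set.univ)
        rw [sdiff_univ]
        exact isCoverable_empty D
      sets_of_superset := fun h hY => h.mono (sdiff_subset_sdiff_right hY)
      inter_sets := fun {Y Y'} h h' => by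
        change IsCoverable L D (D \ (Y ∩ Y'))
        rw [sdiff_inter]
        exact h.union h' }
  have hF : ∀ Y, Y ∈ F ↔ IsCoverable L D (D \ Y) := fun Y => Iff.rfl
  have : F.NeBot := ⟨fun h => hD (by simpa [h] using (hF ∅).symm)⟩
  refine ⟨Ultrafilter.of F, Ultrafilter.of_le F ((hF D).2 ?_), fun Y hY hYD hc => ?_⟩
  · rw [sdiff_self]
    exact isCoverable_empty D
  · have : Yᶜ ∈ F := (hF _).2 (hc.mono fun x hx => not_not.1 hx.2)
    exact Ultrafilter.compl_notMem_iff.2 hY (Ultrafilter.of_le F this)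

/-- The `N`-th iterate of an ultrafilter. -/
def iterUltrafilter {X : Type*} (𝓕 : Ultrafilter X) : (N : ℕ) → Ultrafilter (Fin N → X)
  | 0 => pure Fin.elim0
  | N + 1 => 𝓕.bind fun d => (iterUltrafilter 𝓕 N).map (Fin.cons (α := fun _ => X) d)

theorem mem_iterUltrafilter_succ {X : Type*} (𝓕 : Ultrafilter X) (N : ℕ)
    (S : Set (Fin (N + 1) → X)) : S ∈ iterUltrafilter 𝓕 (N + 1) ↔
      {d | {t | Fin.cons (α := fun _ => X) d t ∈ S} ∈ iterUltrafilter 𝓕 N} ∈ 𝓕 :=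
  Iff.rfl

theorem exists_independent_of_mem_iterUltrafilter {n : ℕ} {D : Set (Fin n → U)}
    {𝓕 : Ultrafilter (Fin n → U)} (hD : D ∈ 𝓕) (h𝓕 : ∀ Y ∈ 𝓕, Y ⊆ D → ¬IsCoverable L D Y)
    (N : ℕ) : ∀ (γ : Type u) (S : Set (γ ⊕ (Fin N × Fin n) → U)), (∅ : Set U).Definable L S →
      ∀ g : γ → U,
        {t : Fin N → Fin n → U | Sum.elim g (fun q => t q.1 q.2) ∈ S} ∈ iterUltrafilter 𝓕 N →
        ∃ a : Fin N → Bool → Fin n → U, (∀ i, a i true ∈ D ∧ a i false ∉ D) ∧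
          ∀ η : Fin N → Bool, Sum.elim g (fun q => a q.1 (η q.1) q.2) ∈ S := by
  classical
  induction N with
  | zero =>
    intro γ S _ g hg
    have hg : Sum.elim g (fun q => (Fin.elim0 q.1 : Fin n → U) q.2) ∈ S := hg
    refine ⟨fun i => i.elim0, fun i => i.elim0, fun η => ?_⟩
    convert! hg using 3
    rename_i q
    exact q.1.elim0
  | succ N ih =>
    intro γ S hS g hg
    let h (d : Fin n → U) (t : Fin N × Fin n → U) : Fin (N + 1) × Fin n → U := fun q =>
      Fin.cases (d q.2) (fun i => t (i, q.2)) q.1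
    let Y : Set (Fin n → U) := D ∩ {d | {t : Fin N → Fin n → U |
      Sum.elim g (h d fun q => t q.1 q.2) ∈ S} ∈ iterUltrafilter 𝓕 N}
    have hY : Y ∈ 𝓕 := by
      refine Filter.inter_mem hD ?_
      have key : ∀ (d : Fin n → U) (t : Fin N → Fin n → U),
          Sum.elim g (h d fun q => t q.1 q.2) =
            Sum.elim g fun q => Fin.cons (α := fun _ => Fin n → U) d t q.1 q.2 := by
        intro d t
        ext (x | ⟨i, j⟩)
        · rfl
        · cases i using Fin.cases <;> rfl
      simp only [key]
      exact (mem_iterUltrafilter_succ 𝓕 N _).1 hg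
    let k (η : Fin N → Bool) : γ ⊕ (Fin (N + 1) × Fin n) → (γ ⊕ (Fin N × Bool × Fin n)) ⊕ Fin n :=
      Sum.elim (fun x => Sum.inl (Sum.inl x)) fun q =>
        Fin.cases (Sum.inr q.2) (fun i => Sum.inl (Sum.inr (i, η i, q.2))) q.1
    have hk : ∀ η g (a : Fin N × Bool × Fin n → U) (d : Fin n → U),
        Sum.elim (Sum.elim g a) d ∘ k η = Sum.elim g (h d fun q => a (q.1, η q.1, q.2)) := by
      intro η g a d
      ext (x | ⟨i, j⟩)
      · rfl
      · cases i using Fin.cases <;> rfl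
    have hθ : (∅ : Set U).Definable L (⋂ η, (fun σ : _ → U => σ ∘ k η) ⁻¹' S) :=
      definable_iInter_of_finite fun η => hS.preimage_comp (k η)
    have hnc := h𝓕 Y hY inter_subset_left
    simp only [IsCoverable, not_exists, not_and, not_forall] at hnc
    obtain ⟨B₀, hB₀Y, hB₀⟩ := hnc _ _ hθ
    obtain ⟨d₀, hd₀⟩ := 𝓕.nonempty_of_mem hY
    let B := insert d₀ B₀
    have hBY : ∀ d ∈ B, d ∈ Y := by
      intro d hd
      rcases Finset.mem_insert.1 hd with rfl | hd
      exacts [hd₀, hB₀Y hd]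
    let f (d : B) : γ ⊕ (Fin (N + 1) × Fin n) → (γ ⊕ (B × Fin n)) ⊕ (Fin N × Fin n) :=
      Sum.elim (fun x => Sum.inl (Sum.inl x)) fun q =>
        Fin.cases (Sum.inl (Sum.inr (d, q.2))) (fun i => Sum.inr (i, q.2)) q.1
    have hf : ∀ (d : B) t, Sum.elim (Sum.elim g fun q : B × Fin n => q.1.1 q.2) t ∘ f d =
        Sum.elim g (h d t) := by
      intro d t
      ext (x | ⟨i, j⟩)
      · rfl
      · cases i using Fin.cases <;> rfl
    obtain ⟨a, haD, ha⟩ := ih _ (⋂ d : B, (fun σ : _ → U => σ ∘ f d) ⁻¹' S)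
      (definable_iInter_of_finite fun d => hS.preimage_comp (f d))
      (Sum.elim g fun q : B × Fin n => q.1.1 q.2) <| by
        have : ∀ᶠ t in (iterUltrafilter 𝓕 N : Filter (Fin N → Fin n → U)),
            ∀ d : B, Sum.elim g (h d fun q => t q.1 q.2) ∈ S :=
          Filter.eventually_all.2 fun d => (hBY d d.2).2
        filter_upwards [this] with t ht
        refine mem_iInter.2 fun d => ?_
        rw [mem_preimage, hf]
        exact ht d
    simp only [mem_iInter, mem_preimage, hf] at ha
    obtain ⟨z, hz, hzD⟩ := hB₀ (Sum.elim g fun q => a q.1 q.2.1 q.2.2) fun d hd => by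
      simp only [mem_iInter, mem_preimage, hk]
      exact fun η => ha η ⟨d, Finset.mem_insert_of_mem hd⟩
    simp only [mem_iInter, mem_preimage, hk] at hz
    refine ⟨Fin.cons (fun b => bif b then d₀ else z) a, fun i => ?_, fun η => ?_⟩
    · cases i using Fin.cases with
      | zero => exact ⟨hd₀.1, hzD⟩
      | succ i => exact haD i
    · have key : ∀ d, (bif η 0 then d₀ else z) = d →
          Sum.elim g (fun q : Fin (N + 1) × Fin n =>
            (Fin.cons (fun b => bif b then d₀ else z) a : Fin (N + 1) → Bool → Fin n → U)
              q.1 (η q.1) q.2) =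
          Sum.elim g (h d fun q => a q.1 (η q.1.succ) q.2) := by
        rintro d rfl
        ext (x | ⟨i, j⟩)
        · rfl
        · cases i using Fin.cases <;> rfl
      rw [key _ rfl]
      cases η 0
      · exact hz fun i => η i.succ
      · exact ha (fun i => η i.succ) ⟨d₀, Finset.mem_insert_self _ _⟩

/-- If `D` is not coverable, then over any small set some `N` tuples satisfy no `∅`-definable
relation that decides their membership in `D`. -/
theorem exists_independent_of_not_isCoverable (hsat : IsSatStr U iS) {n : ℕ}
    {D : Set (Fin n → U)} (hD : ¬IsCoverable L D D) {A : Set U} (hA : #A < #U) (N : ℕ) :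
    ∃ c : Fin N × Fin n → U, ∀ R : Set (↥A ⊕ (Fin N × Fin n) → U), (∅ : Set U).Definable L R →
      Sum.elim Subtype.val c ∈ R → ∀ η : Fin N → Bool, ∃ t : Fin N × Fin n → U,
        Sum.elim Subtype.val t ∈ R ∧ ∀ i, (fun j => t (i, j)) ∈ D ↔ η i = true := by
  obtain ⟨𝓕, hD𝓕, h𝓕⟩ := exists_ultrafilter_of_not_isCoverable hD
  let 𝒮 : Set (Set (↥A ⊕ (Fin N × Fin n) → U)) := {R | (∅ : Set U).Definable L R ∧
    {t : Fin N → Fin n → U | Sum.elim Subtype.val (fun q => t q.1 q.2) ∈ R} ∈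
      iterUltrafilter 𝓕 N}
  obtain ⟨c, hc⟩ := hsat.exists_mem_of_definable hA 𝒮 (fun R hR => hR.1)
    ⟨definable_univ, Filter.univ_mem⟩
    (fun R hR R' hR' => ⟨hR.1.inter hR'.1, Filter.inter_mem hR.2 hR'.2⟩)
    (fun R hR => by
      obtain ⟨t, ht⟩ := (iterUltrafilter 𝓕 N).nonempty_of_mem hR.2
      exact ⟨_, ht⟩)
  refine ⟨c, fun R hR hcR η => ?_⟩
  have hR𝒮 : R ∈ 𝒮 := by
    refine ⟨hR, by_contra fun h => ?_⟩
    exact hc Rᶜ ⟨hR.compl, Ultrafilter.compl_mem_iff_notMem.2 h⟩ hcR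
  obtain ⟨a, haD, ha⟩ :=
    exists_independent_of_mem_iterUltrafilter hD𝓕 h𝓕 N _ R hR Subtype.val hR𝒮.2
  refine ⟨_, ha η, fun i => ?_⟩
  cases h : η i
  · simpa [h] using (haD i).2
  · simpa [h] using (haD i).1

variable (L U) in
/-- The filter of sets of maps `U → U` generated by the `∅`-definable conditions that the identity
satisfies. -/
def idFilter : Filter (U → U) where
  sets := {X | ∃ E : Set (U → U), (∅ : Set U).Definable L E ∧ id ∈ E ∧ E ⊆ X}
  univ_sets := ⟨Set.univ, definable_univ, mem_univ _, Subset.rfl⟩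
  sets_of_superset := fun ⟨E, hE, hid, h⟩ hX => ⟨E, hE, hid, h.trans hX⟩
  inter_sets := fun ⟨E, hE, hid, h⟩ ⟨E', hE', hid', h'⟩ =>
    ⟨E ∩ E', hE.inter hE', ⟨hid, hid'⟩, inter_subset_inter h h'⟩

theorem mem_idFilter_of_definable {E : Set (U → U)} (hE : (∅ : Set U).Definable L E)
    (hid : id ∈ E) : E ∈ idFilter L U :=
  ⟨E, hE, hid, Subset.rfl⟩

/-- The filter `𝓟` only depends on the restriction of maps to `W`. -/
def SupportedOn (W : Set U) (𝓟 : Filter (U → U)) : Prop :=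
  ∃ F : Filter (W → U), 𝓟 = F.comap W.domRestrict

theorem SupportedOn.mono {W W' : Set U} {𝓟 : Filter (U → U)} (h : SupportedOn W 𝓟)
    (hW : W ⊆ W') : SupportedOn W' 𝓟 := by
  obtain ⟨F, rfl⟩ := h
  exact ⟨F.comap (Set.domRestrict₂ (π := fun _ => U) hW), by rw [Filter.comap_comap]; rfl⟩

theorem SupportedOn.inf {W : Set U} {𝓟 𝓠 : Filter (U → U)} (h : SupportedOn W 𝓟)
    (h' : SupportedOn W 𝓠) : SupportedOn W (𝓟 ⊓ 𝓠) := by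
  obtain ⟨F, rfl⟩ := h
  obtain ⟨F', rfl⟩ := h'
  exact ⟨F ⊓ F', Filter.comap_inf.symm⟩

theorem SupportedOn.iInf {ι : Sort*} {W : Set U} {𝓟 : ι → Filter (U → U)}
    (h : ∀ i, SupportedOn W (𝓟 i)) : SupportedOn W (⨅ i, 𝓟 i) := by
  choose F hF using h
  exact ⟨⨅ i, F i, by rw [Filter.comap_iInf]; exact iInf_congr hF⟩

theorem supportedOn_principal {W : Set U} {P : Set (U → U)}
    (h : ∀ v v', EqOn v v' W → v ∈ P → v' ∈ P) : SupportedOn W (Filter.principal P) := by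
  refine ⟨Filter.principal (W.domRestrict '' P), ?_⟩
  rw [Filter.comap_principal]
  congr 1
  refine (subset_preimage_image _ _).antisymm ?_
  rintro v' ⟨v, hv, hvv'⟩
  exact h v v' (Set.domRestrict_eq_domRestrict_iff.1 hvv') hv

/-- A witness for a relation depending on `v` only through `W` can be assumed to be the value of
`v` at some point of `U`. -/
theorem IsSatStr.exists_neBot_witness (hsat : IsSatStr U iS) {W : Set U} (hW : #W < #U)
    {𝓟 : Filter (U → U)} (hs : SupportedOn W 𝓟) (h𝓟 : (idFilter L U ⊓ 𝓟).NeBot)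
    (Q : (U → U) → U → Prop) (hQ : ∀ v v', EqOn v v' W → ∀ y, Q v y → Q v' y) :
    ∃ u, (idFilter L U ⊓ 𝓟 ⊓ Filter.principal {v | ∀ y, Q v y → Q v (v u)}).NeBot := by
  classical
  obtain ⟨F, rfl⟩ := hs
  let 𝓖 : Ultrafilter (U → U) := Ultrafilter.of (idFilter L U ⊓ F.comap W.domRestrict)
  have h𝓖 : (𝓖 : Filter (U → U)) ≤ idFilter L U ⊓ F.comap W.domRestrict := Ultrafilter.of_le _
  have : Nonempty U := mk_ne_zero_iff.1 hW.ne_zero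
  have hex : ∀ v : U → U, ∃ z : Fin 1 → U, ∀ y, Q v y → Q v (z 0) := by
    intro v
    by_cases h : ∃ y, Q v y
    · obtain ⟨y, hy⟩ := h
      exact ⟨fun _ => y, fun _ _ => hy⟩
    · exact ⟨fun _ => Classical.arbitrary U, fun y hy => (h ⟨y, hy⟩).elim⟩
  choose z hz using hex
  let 𝒮 : Set (Set (↥W ⊕ Fin 1 → U)) := {θ | (∅ : Set U).Definable L θ ∧
    ∀ᶠ v in (𝓖 : Filter (U → U)), Sum.elim (W.domRestrict v) (z v) ∈ θ}
  obtain ⟨b, hb⟩ := hsat.exists_mem_of_definable hW 𝒮 (fun R hR => hR.1)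
    ⟨definable_univ, Filter.univ_mem⟩
    (fun R hR R' hR' => ⟨hR.1.inter hR'.1, hR.2.and hR'.2⟩)
    (fun θ hθ => by
      have hE : (∅ : Set U).Definable L {v : U → U | ∃ b, Sum.elim (W.domRestrict v) b ∈ θ} :=
        hθ.1.exists_of_finite.preimage_comp (Subtype.val : W → U)
      by_contra hid
      have hEc := h𝓖 (Filter.mem_inf_of_left (mem_idFilter_of_definable hE.compl hid))
      obtain ⟨v, hv, hv'⟩ := (hθ.2.and hEc).exists
      exact hv' ⟨_, hv⟩)
  refine ⟨b 0, Filter.inf_principal_neBot_iff.2 fun X hX => ?_⟩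
  obtain ⟨X₁, ⟨E, hE, hid, hEX⟩, X₂, ⟨P, hP, hPX⟩, rfl⟩ := Filter.mem_inf_iff.1 hX
  obtain ⟨θ, hθ, hθb, hθE⟩ := definable_restrict W b hE hid
  have hθ𝒮 : θ ∈ 𝒮 := by
    refine ⟨hθ, by_contra fun h => ?_⟩
    exact hb θᶜ ⟨hθ.compl, Ultrafilter.eventually_not.2 h⟩ hθb
  have hP𝓖 := h𝓖 (Filter.mem_inf_of_right (Filter.preimage_mem_comap hP))
  obtain ⟨v, hv, hvP⟩ := (hθ𝒮.2.and hP𝓖).exists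
  obtain ⟨v', hv'E, hv'W, hv'b⟩ := hθE _ hv
  have heq : EqOn v v' W := fun w hw => (hv'W ⟨w, hw⟩).symm
  refine ⟨v', ⟨hEX hv'E, hPX ?_⟩, fun y hy => ?_⟩
  · rwa [mem_preimage, ← Set.domRestrict_eq_domRestrict_iff.2 heq]
  · have : v' (b 0) = z v 0 := hv'b 0
    rw [this]
    exact hQ v v' heq _ (hz v y (hQ v' v heq.symm y hy))

theorem neBot_inf_biInf {I α : Type*} [LinearOrder I] {B : Filter α} (hB : B.NeBot)
    (F : I → Filter α) (s : Set I) (h : ∀ j ∈ s, (B ⊓ ⨅ k, ⨅ _ : k ≤ j, F k).NeBot) :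
    (B ⊓ ⨅ j ∈ s, F j).NeBot := by
  rcases s.eq_empty_or_nonempty with rfl | hs
  · simpa using hB
  have : Nonempty s := hs.to_subtype
  let G : s → Filter α := fun j => B ⊓ ⨅ k, ⨅ _ : k ≤ j.1, F k
  have hG : Antitone G := fun j j' hj => inf_le_inf_left _ <|
    le_iInf₂ fun k (hk : k ≤ j.1) =>
      iInf₂_le (f := fun k (_ : k ≤ j'.1) => F k) k (hk.trans (show j.1 ≤ j'.1 from hj))
  have hne : (⨅ j, G j).NeBot :=
    Filter.iInf_neBot_of_directed' hG.directed_ge fun j => h j j.2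
  obtain ⟨j₀, hj₀⟩ := hs
  refine hne.mono (le_inf ((iInf_le _ ⟨j₀, hj₀⟩).trans inf_le_left) ?_)
  exact le_iInf₂ fun j hj => (iInf_le _ ⟨j, hj⟩).trans (inf_le_right.trans
    (iInf₂_le (f := fun k (_ : k ≤ j) => F k) j le_rfl))

/-- Transfinite iteration of `IsSatStr.exists_neBot_witness`. -/
theorem IsSatStr.exists_henkin_witnesses (hsat : IsSatStr U iS) (hU : ℵ₀ < #U) {I : Type u}
    [LinearOrder I] [WellFoundedLT I] (hI : ∀ i : I, #(Iio i) < #U) {W₀ : Set U}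
    (hW₀ : #W₀ < #U) {𝓟 : Filter (U → U)} (h𝓟 : SupportedOn W₀ 𝓟)
    (hne : (idFilter L U ⊓ 𝓟).NeBot) (Q : I → (U → U) → U → Prop) (S : I → Set U)
    (hS : ∀ i, (S i).Finite)
    (hQ : ∀ i v v', EqOn v v' (S i) → ∀ y, Q i v y → Q i v' y) :
    ∃ w : I → U, (idFilter L U ⊓ 𝓟 ⊓
      ⨅ i, Filter.principal {v | ∀ y, Q i v y → Q i v (v (w i))}).NeBot := by
  have : Nonempty U := mk_ne_zero_iff.1 hW₀.ne_zero
  let H (i : I) (u : U) : Filter (U → U) := Filter.principal {v | ∀ y, Q i v y → Q i v (v u)}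
  let ind : ∀ i : I, (∀ j, j < i → U) → U := fun i w => Classical.epsilon fun u =>
    (idFilter L U ⊓ (𝓟 ⊓ ⨅ j, ⨅ h : j < i, H j (w j h)) ⊓ H i u).NeBot
  let w : I → U := WellFoundedLT.fix ind
  have hw : ∀ i, w i = Classical.epsilon fun u =>
      (idFilter L U ⊓ (𝓟 ⊓ ⨅ j, ⨅ _ : j < i, H j (w j)) ⊓ H i u).NeBot :=
    fun i => WellFoundedLT.fix_eq ind i
  have step : ∀ i, (idFilter L U ⊓ 𝓟 ⊓ ⨅ k, ⨅ _ : k ≤ i, H k (w k)).NeBot := by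
    intro i
    induction i using WellFoundedLT.induction with
    | ind i ih =>
      have hlt := neBot_inf_biInf hne (fun k => H k (w k)) (Iio i) ih
      rw [inf_assoc] at hlt
      let W : Set U := W₀ ∪ (S i ∪ ⋃ j : Iio i, (S j ∪ {w j}))
      have hW : #W < #U := by
        refine (mk_union_le _ _).trans_lt (add_lt_of_lt hU.le hW₀ ?_)
        refine (mk_union_le _ _).trans_lt (add_lt_of_lt hU.le ((hS i).lt_aleph0.trans hU) ?_)
        refine (mk_iUnion_le _).trans_lt (mul_lt_of_lt hU.le (hI i) (lt_of_le_of_lt ?_ hU))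
        exact ciSup_le' fun j => ((hS j).union (finite_singleton _)).lt_aleph0.le
      have hsupp : SupportedOn W (𝓟 ⊓ ⨅ j ∈ Iio i, H j (w j)) := by
        refine (h𝓟.mono subset_union_left).inf (SupportedOn.iInf fun j => SupportedOn.iInf
          fun hj => supportedOn_principal fun v v' hvv' hv y hy => ?_)
        have hsub : S j ∪ {w j} ⊆ W := fun x hx =>
          Or.inr (Or.inr (mem_iUnion.2 ⟨⟨j, hj⟩, hx⟩))
        have hSj : EqOn v v' (S j) := hvv'.mono (subset_union_left.trans hsub)
        rw [← hvv' (hsub (Or.inr rfl))]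
        exact hQ j v v' hSj _ (hv y (hQ j v' v hSj.symm y hy))
      have hex := hsat.exists_neBot_witness hW hsupp hlt (Q i) fun v v' h =>
        hQ i v v' (h.mono fun x hx => Or.inr (Or.inl hx))
      have hi := Classical.epsilon_spec hex
      change (idFilter L U ⊓ (𝓟 ⊓ ⨅ j, ⨅ _ : j < i, H j (w j)) ⊓ H i
        (Classical.epsilon fun u =>
          (idFilter L U ⊓ (𝓟 ⊓ ⨅ j, ⨅ _ : j < i, H j (w j)) ⊓ H i u).NeBot)).NeBot at hi
      rw [← hw i] at hi
      refine hi.mono (le_inf ?_ (le_iInf₂ fun k hk => ?_))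
      · exact inf_le_left.trans (inf_le_inf_left _ inf_le_left)
      · rcases hk.lt_or_eq with hk | rfl
        · exact inf_le_left.trans (inf_le_right.trans (inf_le_right.trans
            (iInf₂_le (f := fun k (_ : k < i) => H k (w k)) k hk)))
        · exact inf_le_right
  refine ⟨w, ?_⟩
  have := neBot_inf_biInf hne (fun k => H k (w k)) Set.univ fun j _ => step j
  simpa using this

theorem eventually_idFilter_funMap {l : ℕ} (f : L.Functions l) (a : Fin l → U) :
    ∀ᶠ v in idFilter L U, Structure.funMap f (v ∘ a) = v (Structure.funMap f a) := by
  refine mem_idFilter_of_definable (empty_definable_iff.2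
    ⟨Term.equal (Term.func f fun i => Term.var (a i)) (Term.var (Structure.funMap f a)), ?_⟩) rfl
  ext v
  simp only [mem_ofPred_eq, Formula.realize_equal, Term.realize_func, Term.realize_var]
  rfl

theorem definable_relMap {l : ℕ} (r : L.Relations l) (a : Fin l → U) :
    (∅ : Set U).Definable L {v : U → U | Structure.RelMap r (v ∘ a)} := by
  refine empty_definable_iff.2 ⟨r.formula fun i => Term.var (a i), ?_⟩
  ext v
  simp only [mem_ofPred_eq, Formula.realize_rel, Term.realize_var]
  rfl

theorem definable_eq (x y : U) : (∅ : Set U).Definable L {v : U → U | v x = v y} := by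
  refine empty_definable_iff.2 ⟨Term.equal (Term.var x) (Term.var y), ?_⟩
  ext v
  simp only [mem_ofPred_eq, Formula.realize_equal, Term.realize_var]

theorem mem_of_definable_iff {𝓖 : Ultrafilter (U → U)} (h𝓖 : (𝓖 : Filter _) ≤ idFilter L U)
    {E : Set (U → U)} (hE : (∅ : Set U).Definable L E) : E ∈ 𝓖 ↔ id ∈ E := by
  refine ⟨fun h => by_contra fun hid => ?_, fun h => h𝓖 (mem_idFilter_of_definable hE h)⟩
  exact Ultrafilter.compl_mem_iff_notMem.1 (h𝓖 (mem_idFilter_of_definable hE.compl hid)) h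

/-- The limit of the preimages of `D` along an ultrafilter. -/
def limitSet {n : ℕ} (𝓖 : Ultrafilter (U → U)) (D : Set (Fin n → U)) : Set (Fin n → U) :=
  {a | ∀ᶠ v in (𝓖 : Filter (U → U)), v ∘ a ∈ D}

theorem eventually_term_realize_eq {n : ℕ} {D : Set (Fin n → U)} {𝓖 : Ultrafilter (U → U)}
    (h𝓖 : (𝓖 : Filter _) ≤ idFilter L U) {α : Type*} (t : (expLang L n).Term α) (s : α → U) :
    ∀ᶠ v in (𝓖 : Filter (U → U)), @Term.realize _ U (expStr L U D) _ (v ∘ s) t =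
      v (@Term.realize _ U (expStr L U (limitSet 𝓖 D)) _ s t) := by
  induction t with
  | var a => exact Filter.Eventually.of_forall fun v => rfl
  | func f ts ih =>
    cases f with
    | inr f => exact f.elim
    | inl f =>
      filter_upwards [Filter.eventually_all.2 ih, h𝓖 (eventually_idFilter_funMap f fun i =>
        @Term.realize _ U (expStr L U (limitSet 𝓖 D)) _ s (ts i))] with v hv hf
      refine Eq.trans ?_ hf
      exact congrArg (Structure.funMap (M := U) f) (funext hv)

/-- Transfer between `D` and its limit along an ultrafilter with witnesses. -/
theorem realize_limitSet_iff {n : ℕ} {D : Set (Fin n → U)} {𝓖 : Ultrafilter (U → U)}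
    (h𝓖 : (𝓖 : Filter _) ≤ idFilter L U)
    (hwit : ∀ ψ : (expLang L n).Formula (U ⊕ Fin 1), ∃ u, ∀ᶠ v in (𝓖 : Filter (U → U)),
      ∀ y, ¬FRealize U (expStr L U D) ψ (Sum.elim v fun _ => y) →
        ¬FRealize U (expStr L U D) ψ (Sum.elim v fun _ => v u)) {k : ℕ}
    (φ : (expLang L n).BoundedFormula U k) (xs : Fin k → U) :
    @BoundedFormula.Realize _ U (expStr L U (limitSet 𝓖 D)) _ _ φ id xs ↔
      ∀ᶠ v in (𝓖 : Filter (U → U)), @BoundedFormula.Realize _ U (expStr L U D) _ _ φ v (v ∘ xs) := by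
  have hterm : ∀ {k : ℕ} (t : (expLang L n).Term (U ⊕ Fin k)) (xs : Fin k → U),
      ∀ᶠ v in (𝓖 : Filter (U → U)),
        @Term.realize _ U (expStr L U D) _ (Sum.elim v (v ∘ xs)) t =
          v (@Term.realize _ U (expStr L U (limitSet 𝓖 D)) _ (Sum.elim id xs) t) := by
    intro k t xs
    convert! eventually_term_realize_eq (D := D) h𝓖 t (Sum.elim id xs) using 4 with v
    ext (x | i) <;> rfl
  induction φ with
  | falsum => exact (Filter.eventually_const (f := (𝓖 : Filter (U → U)))).symm
  | equal t₁ t₂ =>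
    refine (mem_of_definable_iff h𝓖 (definable_eq (L := L)
      (@Term.realize _ U (expStr L U (limitSet 𝓖 D)) _ (Sum.elim id xs) t₁)
      (@Term.realize _ U (expStr L U (limitSet 𝓖 D)) _ (Sum.elim id xs) t₂))).symm.trans ?_
    refine Filter.eventually_congr ?_
    filter_upwards [hterm t₁ xs, hterm t₂ xs] with v h₁ h₂
    change _ ↔ @Term.realize _ U (expStr L U D) _ (Sum.elim v (v ∘ xs)) t₁ =
      @Term.realize _ U (expStr L U D) _ (Sum.elim v (v ∘ xs)) t₂
    rw [h₁, h₂]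
  | rel R ts =>
    have hts := Filter.eventually_all.2 fun i => hterm (ts i) xs
    cases R with
    | inl r =>
      refine (mem_of_definable_iff h𝓖 (definable_relMap r fun i =>
        @Term.realize _ U (expStr L U (limitSet 𝓖 D)) _ (Sum.elim id xs) (ts i))).symm.trans ?_
      refine Filter.eventually_congr ?_
      filter_upwards [hts] with v hv
      exact iff_of_eq (congrArg (Structure.RelMap (M := U) r) (funext hv).symm)
    | inr r =>
      refine Filter.eventually_congr ?_
      filter_upwards [hts] with v hv
      exact iff_of_eq (congrArg (fun x => x ∘ Fin.cast r.down.down.symm ∈ D) (funext hv).symm)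
  | imp φ₁ φ₂ ih₁ ih₂ =>
    exact (imp_congr (ih₁ xs) (ih₂ xs)).trans Ultrafilter.eventually_imp.symm
  | @all k φ ih =>
    let ψ : (expLang L n).Formula (U ⊕ Fin 1) := φ.toFormula.relabel
      (Sum.elim Sum.inl (Fin.lastCases (Sum.inr 0) fun i => Sum.inl (xs i)))
    have hψ : ∀ v y, FRealize U (expStr L U D) ψ (Sum.elim v fun _ => y) ↔
        @BoundedFormula.Realize _ U (expStr L U D) _ _ φ v (Fin.snoc (v ∘ xs) y) := by
      intro v y
      let _ := expStr L U D
      refine (Formula.realize_relabel.trans (BoundedFormula.realize_toFormula φ _)).trans ?_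
      refine iff_of_eq (congrArg₂ (fun a b => φ.Realize a b) rfl (funext fun i => ?_))
      cases i using Fin.lastCases <;> simp
    obtain ⟨u, hu⟩ := hwit ψ
    have hsnoc : ∀ (v : U → U) x, v ∘ (Fin.snoc xs x : Fin (k + 1) → U) =
        Fin.snoc (v ∘ xs) (v x) := fun v x => Fin.comp_snoc v xs x
    change (∀ x, _) ↔ ∀ᶠ v in (𝓖 : Filter (U → U)), ∀ x : U, _
    refine ⟨fun h => ?_, fun h x => (ih _).2 ?_⟩
    · filter_upwards [hu, (ih _).1 (h u)] with v hv hvu y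
      rw [hsnoc, ← hψ] at hvu
      exact (hψ v y).1 (not_not.1 fun hy => hv y hy hvu)
    · filter_upwards [h] with v hv
      rw [hsnoc]
      exact hv (v x)

theorem mk_formula_expLang_le {L : FirstOrder.Language.{u, u}} {U : Type u} (hU : ℵ₀ < #U)
    (hcard : L.card < #U) (n : ℕ) : #((expLang L n).Formula (U ⊕ Fin 1)) ≤ #U := by
  have hpred : (predLang.{u} n).card ≤ ℵ₀ := by
    have : ∀ m, Countable ((predLang.{u} n).Functions m) := fun m =>
      inferInstanceAs (Countable PEmpty)
    have : ∀ m, Countable ((predLang.{u} n).Relations m) := fun m =>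
      inferInstanceAs (Countable (ULift (PLift (m = n))))
    exact mk_le_aleph0_iff.2 inferInstance
  have hL : (expLang L n).card ≤ #U := by
    rw [expLang, Language.card_sum]
    simpa using add_le_of_le hU.le hcard.le (hpred.trans hU.le)
  have hα : #(U ⊕ Fin 1) ≤ #U := by
    simpa using add_le_of_le hU.le le_rfl (one_lt_aleph0.le.trans hU.le)
  have hinj : Function.Injective fun φ : (expLang L n).Formula (U ⊕ Fin 1) =>
      (⟨0, φ⟩ : Σ k, (expLang L n).BoundedFormula (U ⊕ Fin 1) k) := fun φ ψ h => by simpa using h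
  refine (mk_le_of_injective hinj).trans (BoundedFormula.card_le.trans (max_le hU.le ?_))
  simpa using add_le_of_le hU.le hα hL

/-- A realization of a type over `A` which is compatible with a condition on tuples can be moved by
a limit ultrafilter to satisfy that condition, without changing the theory over `A`. -/
theorem IsSatStr.exists_limitSet_mem_eSet (hsat : IsSatStr U iS) (hU : ℵ₀ < #U)
    (hcard : L.card < #U) {n : ℕ} (D : Set (Fin n → U)) {A : Set U} (hA : #A < #U)
    {K : Type*} [Finite K] (c : K → U) (q : (K → U) → Prop)
    (h : ∀ R : Set (↥A ⊕ K → U), (∅ : Set U).Definable L R → Sum.elim Subtype.val c ∈ R →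
      ∃ t, Sum.elim Subtype.val t ∈ R ∧ q t) :
    ∃ 𝓖 : Ultrafilter (U → U), limitSet 𝓖 D ∈ eSet L U A D ∧
      ∀ᶠ v in (𝓖 : Filter (U → U)), q (v ∘ c) := by
  classical
  let 𝓟 : Filter (U → U) := Filter.principal {v | (∀ a ∈ A, v a = a) ∧ q (v ∘ c)}
  have hne : (idFilter L U ⊓ 𝓟).NeBot := by
    refine Filter.inf_principal_neBot_iff.2 fun X ⟨E, hE, hid, hEX⟩ => ?_
    obtain ⟨θ, hθ, hθc, hθE⟩ := definable_restrict A c hE hid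
    obtain ⟨t, ht, hq⟩ := h θ hθ hθc
    obtain ⟨v, hv, hvA, hvc⟩ := hθE _ ht
    have : v ∘ c = t := funext hvc
    exact ⟨v, hEX hv, fun a ha => hvA ⟨a, ha⟩, by rwa [this]⟩
  have hsupp : SupportedOn (A ∪ range c) 𝓟 := by
    refine supportedOn_principal fun v v' hvv' ⟨hvA, hq⟩ => ⟨fun a ha => ?_, ?_⟩
    · rw [← hvv' (Or.inl ha), hvA a ha]
    · have : v' ∘ c = v ∘ c := funext fun k => (hvv' (Or.inr ⟨k, rfl⟩)).symm
      rwa [this]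
  have hW₀ : #(A ∪ range c : Set U) < #U :=
    (mk_union_le _ _).trans_lt (add_lt_of_lt hU.le hA ((finite_range c).lt_aleph0.trans hU))
  let I := (expLang L n).Formula (U ⊕ Fin 1)
  obtain ⟨_, _, hI⟩ := exists_ord_eq_type_lt I
  let Q (i : I) (v : U → U) (y : U) : Prop :=
    ¬FRealize U (expStr L U D) i (Sum.elim v fun _ => y)
  have hfin : ∀ i, ∃ T : Finset (U ⊕ Fin 1), ∀ v v' : U → U,
      EqOn v v' (Sum.inl ⁻¹' (T : Set (U ⊕ Fin 1))) → ∀ y, Q i v y → Q i v' y := by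
    intro i
    let _ := expStr L U D
    have hdef : (∅ : Set U).Definable (expLang L n)
        (Set.ofPred (i.Realize : (U ⊕ Fin 1 → U) → Prop)) := empty_definable_iff.2 ⟨i, rfl⟩
    obtain ⟨T, S, -, hS⟩ := definable_finite_support hdef
    refine ⟨T, fun v v' hvv' y hv hv' => hv ((hS _).2 ?_)⟩
    convert! (hS _).1 hv' using 2 with t
    obtain ⟨x | x, hx⟩ := t
    · exact hvv' hx
    · rfl
  choose T hT using hfin
  obtain ⟨w, hw⟩ := hsat.exists_henkin_witnesses hU
    (fun i : I => (mk_Iio_lt i hI).trans_le (mk_formula_expLang_le hU hcard n))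
    hW₀ hsupp hne Q (fun i => Sum.inl ⁻¹' (T i : Set (U ⊕ Fin 1)))
    (fun i => (T i).finite_toSet.preimage Sum.inl_injective.injOn) hT
  obtain ⟨𝓖, h𝓖⟩ := Ultrafilter.exists_le
    (idFilter L U ⊓ 𝓟 ⊓ ⨅ i, Filter.principal {v | ∀ y, Q i v y → Q i v (v (w i))})
  have h𝓖P : ∀ᶠ v in (𝓖 : Filter (U → U)), (∀ a ∈ A, v a = a) ∧ q (v ∘ c) :=
    h𝓖 (Filter.mem_inf_of_left (Filter.mem_inf_of_right (Filter.mem_principal_self _)))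
  refine ⟨𝓖, fun φ => ?_, h𝓖P.mono fun v hv => hv.2⟩
  have hwit : ∀ ψ : (expLang L n).Formula (U ⊕ Fin 1), ∃ u, ∀ᶠ v in (𝓖 : Filter (U → U)),
      ∀ y, ¬FRealize U (expStr L U D) ψ (Sum.elim v fun _ => y) →
        ¬FRealize U (expStr L U D) ψ (Sum.elim v fun _ => v u) := by
    intro ψ
    exact ⟨w ψ, h𝓖 (Filter.mem_inf_of_right (Filter.mem_iInf_of_mem ψ
      (Filter.mem_principal_self _)))⟩
  let χ : (expLang L n).Formula U := Formula.relabel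
    (Sum.elim Subtype.val Empty.elim : ↥A ⊕ Empty → U) (BoundedFormula.constantsVarsEquiv φ)
  have hχ : ∀ (C : Set (Fin n → U)) (v : U → U), (∀ a ∈ A, v a = a) →
      (SentRealize U (addConsts U (expStr L U C) A) φ ↔ FRealize U (expStr L U C) χ v) := by
    intro C v hv
    refine (frealize_addConsts_iff (iS := expStr L U C) φ default).trans
      (Iff.trans (iff_of_eq (congrArg _ ?_)) (@Formula.realize_relabel _ U (expStr L U C) _ _ _ _ _).symm)
    ext (a | x)
    · exact (hv a a.2).symm
    · exact x.elim
  have htransfer := realize_limitSet_iff (h𝓖.trans (inf_le_left.trans inf_le_left)) hwit χ default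
  rw [hχ (limitSet 𝓖 D) id fun _ _ => rfl]
  refine htransfer.trans ?_
  have hev : ∀ᶠ v in (𝓖 : Filter (U → U)),
      (@BoundedFormula.Realize _ U (expStr L U D) _ _ χ v (v ∘ default) ↔
        SentRealize U (addConsts U (expStr L U D) A) φ) := by
    filter_upwards [h𝓖P] with v hv
    rw [hχ D v hv.1, Subsingleton.elim (v ∘ default) (default : Fin 0 → U)]
    rfl
  exact (Filter.eventually_congr hev).trans Filter.eventually_const

/-- If `e(D/A)` has finite VC-dimension, any set which is `D` or its complement is coverable. -/
theorem isCoverable_of_finiteVC (hsat : IsSatStr U iS) (hU : ℵ₀ < #U) (hcard : L.card < #U)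
    {n : ℕ} {D : Set (Fin n → U)} {A : Set U} (hA : #A < #U) (hvc : FiniteVC (eSet L U A D))
    {D₀ : Set (Fin n → U)} (hD₀ : D₀ = D ∨ D₀ = Dᶜ) : IsCoverable L D₀ D₀ := by
  classical
  by_contra hnc
  obtain ⟨N, hN⟩ := hvc
  obtain ⟨c, hc⟩ := exists_independent_of_not_isCoverable hsat hnc hA N
  have hind : ∀ η : Fin N → Bool, ∃ C ∈ eSet L U A D,
      ∀ i, (fun j => c (i, j)) ∈ C ↔ η i = true := by
    intro η
    obtain ⟨𝓖, h𝓖, hη⟩ := hsat.exists_limitSet_mem_eSet hU hcard D hA c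
      (fun t => ∀ i, (fun j => t (i, j)) ∈ D ↔ η i = true) fun R hR hcR => by
        rcases hD₀ with rfl | rfl
        · exact hc R hR hcR η
        · obtain ⟨t, ht, hη⟩ := hc R hR hcR fun i => !η i
          refine ⟨t, ht, fun i => ?_⟩
          have := hη i
          rw [mem_compl_iff] at this
          cases h : η i
          · simpa [h] using this
          · simpa [h, not_not] using this
    refine ⟨_, h𝓖, fun i => ?_⟩
    exact (Filter.eventually_congr (hη.mono fun v hv => hv i)).trans Filter.eventually_const
  have hinj : Function.Injective fun i j => c (i, j) := by
    intro i i' h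
    obtain ⟨C, -, hC⟩ := hind fun k => decide (k = i)
    have hi : (fun j => c (i, j)) ∈ C := (hC i).2 (by simp)
    have h : (fun j => c (i, j)) = fun j => c (i', j) := h
    rw [h, hC i'] at hi
    exact (of_decide_eq_true hi).symm
  refine hN (Finset.univ.image fun i j => c (i, j))
    (by rw [Finset.card_image_of_injective _ hinj]; simp) fun H hH => ?_
  obtain ⟨C, hCe, hC⟩ := hind fun i => decide ((fun j => c (i, j)) ∈ H)
  refine ⟨C, hCe, ?_⟩
  ext a
  constructor
  · rintro ⟨haC, haB⟩
    obtain ⟨i, -, rfl⟩ := Finset.mem_image.1 haB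
    exact of_decide_eq_true ((hC i).1 haC)
  · intro haH
    refine ⟨?_, hH haH⟩
    obtain ⟨i, -, rfl⟩ := Finset.mem_image.1 (hH haH)
    exact (hC i).2 (decide_eq_true haH)

theorem finite_tuplesIn (n : ℕ) (B : Finset U) : (tuplesIn (n := n) U (B : Set U)).Finite := by
  have := Set.Finite.pi' (ι := Fin n) fun _ => B.finite_toSet
  exact this

theorem IsCoverable.approxBelow {n : ℕ} {D : Set (Fin n → U)} (h : IsCoverable L D D) :
    ApproxBelow L U D := by
  classical
  obtain ⟨P, R, hR, h⟩ := h
  obtain ⟨T, S, hS, hTS⟩ := definable_finite_support hR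
  obtain ⟨φ, rfl⟩ := empty_definable_iff.1 hS
  have : Finite {p : P // Sum.inl p ∈ T} :=
    (T.finite_toSet.preimage Sum.inl_injective.injOn).to_subtype
  obtain ⟨m, ⟨e⟩⟩ := Finite.exists_equiv_fin {p : P // Sum.inl p ∈ T}
  let f : T → Fin m ⊕ Fin n
    | ⟨Sum.inl p, hp⟩ => Sum.inl (e ⟨p, hp⟩)
    | ⟨Sum.inr j, _⟩ => Sum.inr j
  have hf : ∀ (b : P → U) (a : Fin n → U),
      a ∈ phiSet L U (φ.relabel f) (fun i => b (e.symm i)) ↔ Sum.elim b a ∈ R := by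
    intro b a
    refine (Formula.realize_relabel (φ := φ)).trans (Iff.trans ?_ (hTS _).symm)
    refine iff_of_eq (congrArg φ.Realize (funext fun ⟨t, ht⟩ => ?_))
    rcases t with p | j
    · simp [f]
    · rfl
  refine ⟨m, φ.relabel f, fun B => ?_⟩
  obtain ⟨b, hbD, hbR⟩ := h ((finite_tuplesIn n B).toFinset.filter (· ∈ D))
    fun a ha => (Finset.mem_filter.1 ha).2
  have hsub : phiSet L U (φ.relabel f) (fun i => b (e.symm i)) ⊆ D :=
    fun a ha => hbR a ((hf b a).1 ha)
  refine ⟨_, (inter_subset_inter_left _ hsub).antisymm fun a ha => ⟨(hf b a).2 (hbD a ?_), ha.2⟩,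
    hsub⟩
  simpa using ha.symm

theorem phiSet_not {m n : ℕ} (φ : L.Formula (Fin m ⊕ Fin n)) (b : Fin m → U) :
    phiSet L U φ.not b = (phiSet L U φ b)ᶜ :=
  rfl

theorem approxAbove_of_approxBelow_compl {n : ℕ} {D : Set (Fin n → U)}
    (h : ApproxBelow L U Dᶜ) : ApproxAbove L U D := by
  obtain ⟨m, φ, h⟩ := h
  refine ⟨m, φ.not, fun B => ?_⟩
  obtain ⟨b, hb, hbD⟩ := h B
  refine ⟨b, ?_⟩
  rw [phiSet_not]
  refine ⟨?_, subset_compl_comm.1 hbD⟩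
  ext a
  have := congrArg (a ∈ ·) hb
  simp only [mem_inter_iff, mem_compl_iff, eq_iff_iff] at this ⊢
  tauto

theorem frealize_instFormula {m n : ℕ} (φ : L.Formula (Fin m ⊕ Fin n)) (a : Fin n → U)
    (b : Fin m → U) :
    FRealize U (addAllConsts U iS) (instFormula L U φ a) b ↔ a ∈ phiSet L U φ b := by
  let _ : (constantsOn U).Structure U := constantsOn.structure id
  refine (BoundedFormula.realize_subst (M := U)).trans
    ((LHom.realize_onFormula (M := U) (L.lhomWithConstants U) φ).trans ?_)
  refine iff_of_eq (congrArg φ.Realize (funext fun t => ?_))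
  rcases t with i | j
  · rfl
  · exact Term.realize_constants

theorem ApproxBelow.extDefinable {n : ℕ} {D : Set (Fin n → U)} (h : ApproxBelow L U D) :
    ExtDefinable L U D := by
  classical
  obtain ⟨m, φ, h⟩ := h
  let F (B : Finset U) : Filter (Fin m → U) :=
    Filter.principal {b | ∀ a ∈ tuplesIn U (B : Set U), a ∈ phiSet L U φ b ↔ a ∈ D}
  have hF : Antitone F := fun B B' hB => Filter.principal_mono.2 fun b hb a ha =>
    hb a fun i => hB (ha i)
  have hne : (⨅ B, F B).NeBot := by
    refine Filter.iInf_neBot_of_directed' hF.directed_ge fun B => Filter.principal_neBot_iff.2 ?_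
    obtain ⟨b, hb, -⟩ := h B
    refine ⟨b, fun a ha => ?_⟩
    have := congrArg (a ∈ ·) hb
    simpa only [mem_inter_iff, ha, and_true, eq_iff_iff] using this
  obtain ⟨𝓖, h𝓖⟩ := Ultrafilter.exists_le (⨅ B, F B)
  refine ⟨m, φ, {ψ | ∀ᶠ b in (𝓖 : Filter _), FRealize U (addAllConsts U iS) ψ b},
    ⟨fun s hs => ?_, fun ψ => ?_⟩, ?_⟩
  · have : ∀ᶠ b in (𝓖 : Filter (Fin m → U)), ∀ ψ ∈ s, FRealize U (addAllConsts U iS) ψ b :=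
      (Filter.eventually_all_finset s).2 fun ψ hψ => hs hψ
    exact this.exists
  · have := Ultrafilter.eventually_not (f := 𝓖) (p := FRealize U (addAllConsts U iS) ψ)
    exact (not_iff_comm.1 this.symm).symm
  · ext a
    have ha : ∀ᶠ b in (𝓖 : Filter (Fin m → U)), (a ∈ phiSet L U φ b ↔ a ∈ D) := by
      filter_upwards [h𝓖 (Filter.mem_iInf_of_mem (Finset.univ.image a)
        (Filter.mem_principal_self _))] with b hb
      exact hb a fun i => by simp
    simp only [mem_ofPred_eq, frealize_instFormula]
    exact ((Filter.eventually_congr ha).trans Filter.eventually_const).symm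

end Approximation

/-- if `e(D/A)` has finite VC dimension for some small `A`, then `D` is
approximable from below and from above (in particular, externally definable). -/
theorem stmt9 (L : FirstOrder.Language.{u, u}) (U : Type u) [iS : L.Structure U]
    (hsat : IsSatStr U iS) (hinacc : Cardinal.IsInaccessible #U) (hcard : L.card < #U)
    (n : ℕ) (D : Set (Fin n → U)) (A : Set U) (hA : #A < #U)
    (hvc : FiniteVC (eSet L U A D)) :
    ApproxBelow L U D ∧ ApproxAbove L U D ∧ ExtDefinable L U D := by
  have hU := hinacc.1
  have hD := isCoverable_of_finiteVC hsat hU hcard hA hvc (Or.inl rfl)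
  have hDc := isCoverable_of_finiteVC hsat hU hcard hA hvc (Or.inr rfl)
  exact ⟨hD.approxBelow, approxAbove_of_approxBelow_compl hDc.approxBelow,
    hD.approxBelow.extDefinable⟩

end Paper
end
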